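/- arXiv:1401.8201 — 2 statements merged into one kernel-verified Lean document; each statement's English description precedes it below -/
import Mathlib

section
/- For all sets F1 and F2 of nonbasic features, N(F1) ≤bool N(F2) if and only if F1 ⊆ F̄2 or F̃1 ⊆ F̄2. -/
namespace NavGraph

/-- The nonbasic features of the navigational algebra. -/
inductive Feature : Type
  | di | conv | inter | diff | proj | coproj
  deriving DecidableEq

/-- A graph over the label set `Λ`: it assigns to each label a binary relation
on the infinite universe of nodes (here `ℕ`). -/
def Graph (Λ : Type) : Type := Λ → Set (ℕ × ℕ)

/-- The active domain of a graph. -/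
def adom {Λ : Type} (G : Graph Λ) : Set ℕ :=
  {m | ∃ n : ℕ, ∃ R : Λ, (m, n) ∈ G R ∨ (n, m) ∈ G R}

/-- A graph is finite if each of its relations is finite. -/
def Graph.Finite {Λ : Type} (G : Graph Λ) : Prop := ∀ R : Λ, Set.Finite (G R)

/-- Expressions of the navigational algebra (with all nonbasic features). -/
inductive Expr (Λ : Type) : Type
  | rel (R : Λ)
  | empty
  | id
  | comp (e₁ e₂ : Expr Λ)
  | union (e₁ e₂ : Expr Λ)
  | di
  | conv (e : Expr Λ)
  | inter (e₁ e₂ : Expr Λ)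
  | diff (e₁ e₂ : Expr Λ)
  | proj1 (e : Expr Λ)
  | proj2 (e : Expr Λ)
  | coproj1 (e : Expr Λ)
  | coproj2 (e : Expr Λ)

/-- Semantics of expressions on graphs. -/
def eval {Λ : Type} : Expr Λ → Graph Λ → Set (ℕ × ℕ)
  | .rel R, G => G R
  | .empty, _ => ∅
  | .id, G => {p | p.1 = p.2 ∧ p.1 ∈ adom G}
  | .comp e₁ e₂, G => {p | ∃ z : ℕ, (p.1, z) ∈ eval e₁ G ∧ (z, p.2) ∈ eval e₂ G}
  | .union e₁ e₂, G => eval e₁ G ∪ eval e₂ G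
  | .di, G => {p | p.1 ∈ adom G ∧ p.2 ∈ adom G ∧ p.1 ≠ p.2}
  | .conv e, G => {p | (p.2, p.1) ∈ eval e G}
  | .inter e₁ e₂, G => eval e₁ G ∩ eval e₂ G
  | .diff e₁ e₂, G => eval e₁ G \ eval e₂ G
  | .proj1 e, G => {p | p.1 = p.2 ∧ p.1 ∈ adom G ∧ ∃ n : ℕ, (p.1, n) ∈ eval e G}
  | .proj2 e, G => {p | p.1 = p.2 ∧ p.1 ∈ adom G ∧ ∃ n : ℕ, (n, p.1) ∈ eval e G}
  | .coproj1 e, G => {p | p.1 = p.2 ∧ p.1 ∈ adom G ∧ ¬ ∃ n : ℕ, (p.1, n) ∈ eval e G}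
  | .coproj2 e, G => {p | p.1 = p.2 ∧ p.1 ∈ adom G ∧ ¬ ∃ n : ℕ, (n, p.1) ∈ eval e G}

/-- `e.InFrag F` holds if `e` is an expression of the language `N(F)`, i.e. it
only uses the basic operators and nonbasic features from `F`. -/
def Expr.InFrag {Λ : Type} (F : Set Feature) : Expr Λ → Prop
  | .rel _ => True
  | .empty => True
  | .id => True
  | .comp e₁ e₂ => e₁.InFrag F ∧ e₂.InFrag F
  | .union e₁ e₂ => e₁.InFrag F ∧ e₂.InFrag F
  | .di => Feature.di ∈ F
  | .conv e => Feature.conv ∈ F ∧ e.InFrag F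
  | .inter e₁ e₂ => Feature.inter ∈ F ∧ e₁.InFrag F ∧ e₂.InFrag F
  | .diff e₁ e₂ => Feature.diff ∈ F ∧ e₁.InFrag F ∧ e₂.InFrag F
  | .proj1 e => Feature.proj ∈ F ∧ e.InFrag F
  | .proj2 e => Feature.proj ∈ F ∧ e.InFrag F
  | .coproj1 e => Feature.coproj ∈ F ∧ e.InFrag F
  | .coproj2 e => Feature.coproj ∈ F ∧ e.InFrag F

/-- Membership in the closure `F̄` of a set of nonbasic features. -/
inductive InClosure (F : Set Feature) : Feature → Prop
  | base {x : Feature} : x ∈ F → InClosure F x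
  | proj_of_coproj : InClosure F .coproj → InClosure F .proj
  | proj_of_inter_di : InClosure F .inter → InClosure F .di → InClosure F .proj
  | proj_of_inter_conv : InClosure F .inter → InClosure F .conv → InClosure F .proj
  | coproj_of_diff_proj : InClosure F .diff → InClosure F .proj → InClosure F .coproj
  | inter_of_diff : InClosure F .diff → InClosure F .inter

/-- The closure `F̄` of a set of nonbasic features. -/
def closure (F : Set Feature) : Set Feature := {x | InClosure F x}

open Classical in
/-- The set `F̃`: replace converse by projection when converse is available but
intersection is not. -/
noncomputable def tilde (F : Set Feature) : Set Feature :=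
  if Feature.conv ∈ closure F ∧ Feature.inter ∉ closure F then
    (F \ {Feature.conv}) ∪ {Feature.proj}
  else F

/-- `N(F₁) ≤path N(F₂)`: every path query expressible in `N(F₁)` is expressible
in `N(F₂)`. -/
def leqPath (Λ : Type) (F₁ F₂ : Set Feature) : Prop :=
  ∀ e₁ : Expr Λ, e₁.InFrag F₁ →
    ∃ e₂ : Expr Λ, e₂.InFrag F₂ ∧ ∀ G : Graph Λ, eval e₂ G = eval e₁ G

/-- `N(F₁) ≤bool N(F₂)`: every boolean query expressible in `N(F₁)` is
expressible in `N(F₂)`. -/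
def leqBool (Λ : Type) (F₁ F₂ : Set Feature) : Prop :=
  ∀ e₁ : Expr Λ, e₁.InFrag F₁ →
    ∃ e₂ : Expr Λ, e₂.InFrag F₂ ∧
      ∀ G : Graph Λ, ((eval e₂ G).Nonempty ↔ (eval e₁ G).Nonempty)

/-- Strong separability at the level of boolean queries. -/
def StrongSepBool (Λ : Type) (F₁ F₂ : Set Feature) : Prop :=
  ∃ (e₁ : Expr Λ) (G₁ G₂ : Graph Λ), e₁.InFrag F₁ ∧ G₁.Finite ∧ G₂.Finite ∧
    (eval e₁ G₁).Nonempty ∧ ¬ (eval e₁ G₂).Nonempty ∧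
    ∀ e₂ : Expr Λ, e₂.InFrag F₂ → ((eval e₂ G₁).Nonempty ↔ (eval e₂ G₂).Nonempty)

/-- Strong separability at the level of path queries. -/
def StrongSepPath (Λ : Type) (F₁ F₂ : Set Feature) : Prop :=
  ∃ (e₁ : Expr Λ) (G : Graph Λ), e₁.InFrag F₁ ∧ G.Finite ∧
    ∀ e₂ : Expr Λ, e₂.InFrag F₂ → eval e₂ G ≠ eval e₁ G

/-- The `n`-fold composition `R ∘ ⋯ ∘ R` (with `R⁰ = id`). -/
def rpow {Λ : Type} (R : Λ) : ℕ → Expr Λ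
  | 0 => .id
  | n + 1 => .comp (.rel R) (rpow R n)

/-- The degree of an expression: the maximum depth of nested applications of
composition, projection and coprojection. -/
def degree {Λ : Type} : Expr Λ → ℕ
  | .rel _ => 0
  | .empty => 0
  | .id => 0
  | .di => 0
  | .comp e₁ e₂ => max (degree e₁) (degree e₂) + 1
  | .union e₁ e₂ => max (degree e₁) (degree e₂)
  | .conv e => degree e
  | .inter e₁ e₂ => max (degree e₁) (degree e₂)
  | .diff e₁ e₂ => max (degree e₁) (degree e₂)
  | .proj1 e => degree e + 1
  | .proj2 e => degree e + 1
  | .coproj1 e => degree e + 1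
  | .coproj2 e => degree e + 1

end NavGraph

namespace NavGraph

section Basics

variable {Λ : Type}

theorem mem_adom_of_mem_eval {G : Graph Λ} (e : Expr Λ) :
    ∀ {m n : ℕ}, (m, n) ∈ eval e G → m ∈ adom G ∧ n ∈ adom G := by
  induction e with
  | rel R => exact fun h => ⟨⟨_, R, .inl h⟩, ⟨_, R, .inr h⟩⟩
  | empty => exact fun h => h.elim
  | id => rintro m n ⟨h, h'⟩; exact ⟨h', (show m = n from h) ▸ h'⟩
  | comp e₁ e₂ ih₁ ih₂ => rintro m n ⟨z, h₁, h₂⟩; exact ⟨(ih₁ h₁).1, (ih₂ h₂).2⟩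
  | union e₁ e₂ ih₁ ih₂ => rintro m n (h | h); exacts [ih₁ h, ih₂ h]
  | di => rintro m n ⟨h, h', -⟩; exact ⟨h, h'⟩
  | conv e ih => exact fun h => (ih h).symm
  | inter e₁ e₂ ih₁ ih₂ => exact fun h => ih₁ h.1
  | diff e₁ e₂ ih₁ ih₂ => exact fun h => ih₁ h.1
  | proj1 e ih => rintro m n ⟨h, h', -⟩; exact ⟨h', (show m = n from h) ▸ h'⟩
  | proj2 e ih => rintro m n ⟨h, h', -⟩; exact ⟨h', (show m = n from h) ▸ h'⟩
  | coproj1 e ih => rintro m n ⟨h, h', -⟩; exact ⟨h', (show m = n from h) ▸ h'⟩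
  | coproj2 e ih => rintro m n ⟨h, h', -⟩; exact ⟨h', (show m = n from h) ▸ h'⟩

theorem Expr.InFrag.mono {F F' : Set Feature} (hF : F ⊆ F') {e : Expr Λ} (he : e.InFrag F) :
    e.InFrag F' := by
  induction e <;> simp_all [Expr.InFrag] <;> first | exact hF he | exact hF he.1

/-- The path query `Q` is expressible in `N(F)`. -/
def PathDef (F : Set Feature) (Q : Graph Λ → Set (ℕ × ℕ)) : Prop :=
  ∃ e : Expr Λ, e.InFrag F ∧ ∀ G, eval e G = Q G

/-- The operator belonging to a feature can be simulated in `N(F)`. -/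
def Supports (Λ : Type) (F : Set Feature) : Feature → Prop
  | .di => PathDef (Λ := Λ) F (eval .di)
  | .conv => ∀ e : Expr Λ, e.InFrag F → PathDef F (eval (.conv e))
  | .inter => ∀ e₁ e₂ : Expr Λ, e₁.InFrag F → e₂.InFrag F → PathDef F (eval (.inter e₁ e₂))
  | .diff => ∀ e₁ e₂ : Expr Λ, e₁.InFrag F → e₂.InFrag F → PathDef F (eval (.diff e₁ e₂))
  | .proj => ∀ e : Expr Λ, e.InFrag F →
      PathDef F (eval (.proj1 e)) ∧ PathDef F (eval (.proj2 e))
  | .coproj => ∀ e : Expr Λ, e.InFrag F →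
      PathDef F (eval (.coproj1 e)) ∧ PathDef F (eval (.coproj2 e))

theorem supports_of_mem_closure {F : Set Feature} {x : Feature} (hx : x ∈ closure F) :
    Supports Λ F x := by
  change InClosure F x at hx
  induction hx with
  | @base x h =>
    cases x with
    | di => exact ⟨.di, h, fun _ => rfl⟩
    | conv => exact fun e he => ⟨.conv e, ⟨h, he⟩, fun _ => rfl⟩
    | inter => exact fun e₁ e₂ h₁ h₂ => ⟨.inter e₁ e₂, ⟨h, h₁, h₂⟩, fun _ => rfl⟩
    | diff => exact fun e₁ e₂ h₁ h₂ => ⟨.diff e₁ e₂, ⟨h, h₁, h₂⟩, fun _ => rfl⟩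
    | proj => exact fun e he =>
        ⟨⟨.proj1 e, ⟨h, he⟩, fun _ => rfl⟩, ⟨.proj2 e, ⟨h, he⟩, fun _ => rfl⟩⟩
    | coproj => exact fun e he =>
        ⟨⟨.coproj1 e, ⟨h, he⟩, fun _ => rfl⟩, ⟨.coproj2 e, ⟨h, he⟩, fun _ => rfl⟩⟩
  | proj_of_coproj _ ih =>
    intro e he
    obtain ⟨⟨a, ha, ha'⟩, ⟨b, hb, hb'⟩⟩ := ih e he
    obtain ⟨⟨a₂, ha₂, ha₂'⟩, -⟩ := ih a ha
    obtain ⟨⟨b₂, hb₂, hb₂'⟩, -⟩ := ih b hb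
    refine ⟨⟨a₂, ha₂, fun G => ?_⟩, ⟨b₂, hb₂, fun G => ?_⟩⟩
    · ext ⟨m, n⟩
      simp only [ha₂', eval, ha', Set.mem_ofPred_eq]
      grind
    · ext ⟨m, n⟩
      simp only [hb₂', eval, hb', Set.mem_ofPred_eq]
      grind
  | proj_of_inter_di _ _ ih₁ ih₂ =>
    intro e he
    obtain ⟨d, hd, hd'⟩ := ih₂
    obtain ⟨a, ha, ha'⟩ := ih₁ (.comp e (.union .id d)) .id ⟨he, trivial, hd⟩ trivial
    obtain ⟨b, hb, hb'⟩ := ih₁ (.comp (.union .id d) e) .id ⟨⟨trivial, hd⟩, he⟩ trivial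
    refine ⟨⟨a, ha, fun G => ?_⟩, ⟨b, hb, fun G => ?_⟩⟩
    · ext ⟨m, n⟩
      have := @mem_adom_of_mem_eval Λ G e
      simp only [ha', eval, hd', Set.mem_ofPred_eq, Set.mem_inter_iff, Set.mem_union]
      grind
    · ext ⟨m, n⟩
      have := @mem_adom_of_mem_eval Λ G e
      simp only [hb', eval, hd', Set.mem_ofPred_eq, Set.mem_inter_iff, Set.mem_union]
      grind
  | proj_of_inter_conv _ _ ih₁ ih₂ =>
    intro e he
    obtain ⟨c, hc, hc'⟩ := ih₂ e he
    obtain ⟨a, ha, ha'⟩ := ih₁ (.comp e c) .id ⟨he, hc⟩ trivial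
    obtain ⟨b, hb, hb'⟩ := ih₁ (.comp c e) .id ⟨hc, he⟩ trivial
    refine ⟨⟨a, ha, fun G => ?_⟩, ⟨b, hb, fun G => ?_⟩⟩
    · ext ⟨m, n⟩
      simp only [ha', eval, hc', Set.mem_ofPred_eq, Set.mem_inter_iff]
      grind
    · ext ⟨m, n⟩
      simp only [hb', eval, hc', Set.mem_ofPred_eq, Set.mem_inter_iff]
      grind
  | coproj_of_diff_proj _ _ ih₁ ih₂ =>
    intro e he
    obtain ⟨⟨a, ha, ha'⟩, ⟨b, hb, hb'⟩⟩ := ih₂ e he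
    obtain ⟨a₂, ha₂, ha₂'⟩ := ih₁ .id a trivial ha
    obtain ⟨b₂, hb₂, hb₂'⟩ := ih₁ .id b trivial hb
    refine ⟨⟨a₂, ha₂, fun G => ?_⟩, ⟨b₂, hb₂, fun G => ?_⟩⟩
    · ext ⟨m, n⟩
      simp only [ha₂', eval, ha', Set.mem_ofPred_eq, Set.mem_sdiff]
      grind
    · ext ⟨m, n⟩
      simp only [hb₂', eval, hb', Set.mem_ofPred_eq, Set.mem_sdiff]
      grind
  | inter_of_diff _ ih =>
    intro e₁ e₂ h₁ h₂
    obtain ⟨a, ha, ha'⟩ := ih e₁ e₂ h₁ h₂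
    obtain ⟨b, hb, hb'⟩ := ih e₁ a h₁ ha
    refine ⟨b, hb, fun G => ?_⟩
    simp only [hb', eval, ha', Set.sdiff_sdiff_right_self]

theorem leqPath_closure (Λ : Type) (F : Set Feature) : leqPath Λ (closure F) F := by
  intro e
  induction e with
  | rel R => exact fun _ => ⟨.rel R, trivial, fun _ => rfl⟩
  | empty => exact fun _ => ⟨.empty, trivial, fun _ => rfl⟩
  | id => exact fun _ => ⟨.id, trivial, fun _ => rfl⟩
  | comp e₁ e₂ ih₁ ih₂ =>
    rintro ⟨h₁, h₂⟩
    obtain ⟨a, ha, ha'⟩ := ih₁ h₁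
    obtain ⟨b, hb, hb'⟩ := ih₂ h₂
    exact ⟨.comp a b, ⟨ha, hb⟩, fun G => by simp only [eval, ha', hb']⟩
  | union e₁ e₂ ih₁ ih₂ =>
    rintro ⟨h₁, h₂⟩
    obtain ⟨a, ha, ha'⟩ := ih₁ h₁
    obtain ⟨b, hb, hb'⟩ := ih₂ h₂
    exact ⟨.union a b, ⟨ha, hb⟩, fun G => by simp only [eval, ha', hb']⟩
  | di => exact fun h => supports_of_mem_closure h
  | conv e ih =>
    rintro ⟨h, h₁⟩
    obtain ⟨a, ha, ha'⟩ := ih h₁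
    obtain ⟨b, hb, hb'⟩ := supports_of_mem_closure (Λ := Λ) h a ha
    exact ⟨b, hb, fun G => by simp only [hb', eval, ha']⟩
  | inter e₁ e₂ ih₁ ih₂ =>
    rintro ⟨h, h₁, h₂⟩
    obtain ⟨a, ha, ha'⟩ := ih₁ h₁
    obtain ⟨b, hb, hb'⟩ := ih₂ h₂
    obtain ⟨c, hc, hc'⟩ := supports_of_mem_closure (Λ := Λ) h a b ha hb
    exact ⟨c, hc, fun G => by simp only [hc', eval, ha', hb']⟩
  | diff e₁ e₂ ih₁ ih₂ =>
    rintro ⟨h, h₁, h₂⟩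
    obtain ⟨a, ha, ha'⟩ := ih₁ h₁
    obtain ⟨b, hb, hb'⟩ := ih₂ h₂
    obtain ⟨c, hc, hc'⟩ := supports_of_mem_closure (Λ := Λ) h a b ha hb
    exact ⟨c, hc, fun G => by simp only [hc', eval, ha', hb']⟩
  | proj1 e ih =>
    rintro ⟨h, h₁⟩
    obtain ⟨a, ha, ha'⟩ := ih h₁
    obtain ⟨b, hb, hb'⟩ := (supports_of_mem_closure (Λ := Λ) h a ha).1
    exact ⟨b, hb, fun G => by simp only [hb', eval, ha']⟩
  | proj2 e ih =>
    rintro ⟨h, h₁⟩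
    obtain ⟨a, ha, ha'⟩ := ih h₁
    obtain ⟨b, hb, hb'⟩ := (supports_of_mem_closure (Λ := Λ) h a ha).2
    exact ⟨b, hb, fun G => by simp only [hb', eval, ha']⟩
  | coproj1 e ih =>
    rintro ⟨h, h₁⟩
    obtain ⟨a, ha, ha'⟩ := ih h₁
    obtain ⟨b, hb, hb'⟩ := (supports_of_mem_closure (Λ := Λ) h a ha).1
    exact ⟨b, hb, fun G => by simp only [hb', eval, ha']⟩
  | coproj2 e ih =>
    rintro ⟨h, h₁⟩
    obtain ⟨a, ha, ha'⟩ := ih h₁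
    obtain ⟨b, hb, hb'⟩ := (supports_of_mem_closure (Λ := Λ) h a ha).2
    exact ⟨b, hb, fun G => by simp only [hb', eval, ha']⟩

theorem leqPath.leqBool {F₁ F₂ : Set Feature} (h : leqPath Λ F₁ F₂) : leqBool Λ F₁ F₂ := by
  intro e he
  obtain ⟨a, ha, ha'⟩ := h e he
  exact ⟨a, ha, fun G => by rw [ha']⟩

theorem leqBool.trans {F₁ F₂ F₃ : Set Feature} (h : leqBool Λ F₁ F₂) (h' : leqBool Λ F₂ F₃) :
    leqBool Λ F₁ F₃ := by
  intro e he
  obtain ⟨a, ha, ha'⟩ := h e he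
  obtain ⟨b, hb, hb'⟩ := h' a ha
  exact ⟨b, hb, fun G => (hb' G).trans (ha' G)⟩

theorem leqBool_of_subset {F₁ F₂ : Set Feature} (h : F₁ ⊆ closure F₂) : leqBool Λ F₁ F₂ :=
  leqPath.leqBool fun e he => leqPath_closure Λ F₂ e (he.mono h)

end Basics

section Converse

variable {Λ : Type}

/-- The node query `Q` is expressible in `N(F)` as a subset of the identity. -/
def NodeDef (F : Set Feature) (Q : Graph Λ → Set ℕ) : Prop :=
  PathDef F fun G => {p | p.1 = p.2 ∧ p.1 ∈ Q G}

theorem NodeDef.congr {F : Set Feature} {Q Q' : Graph Λ → Set ℕ} (h : NodeDef F Q)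
    (hQ : ∀ G x, x ∈ Q G ↔ x ∈ Q' G) : NodeDef F Q' := by
  have : Q = Q' := funext fun G => Set.ext (hQ G)
  exact this ▸ h

theorem NodeDef.adom (F : Set Feature) : NodeDef (Λ := Λ) F adom :=
  ⟨.id, trivial, fun _ => rfl⟩

theorem NodeDef.empty (F : Set Feature) : NodeDef (Λ := Λ) F fun _ => ∅ :=
  ⟨.empty, trivial, fun _ => by simp [eval]⟩

theorem NodeDef.inter {F : Set Feature} {Q Q' : Graph Λ → Set ℕ} (h : NodeDef F Q)
    (h' : NodeDef F Q') : NodeDef F fun G => Q G ∩ Q' G := by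
  obtain ⟨a, ha, ha'⟩ := h
  obtain ⟨b, hb, hb'⟩ := h'
  refine ⟨.comp a b, ⟨ha, hb⟩, fun G => ?_⟩
  ext ⟨m, n⟩
  simp only [eval, ha', hb', Set.mem_ofPred_eq, Set.mem_inter_iff]
  grind

theorem NodeDef.union {F : Set Feature} {Q Q' : Graph Λ → Set ℕ} (h : NodeDef F Q)
    (h' : NodeDef F Q') : NodeDef F fun G => Q G ∪ Q' G := by
  obtain ⟨a, ha, ha'⟩ := h
  obtain ⟨b, hb, hb'⟩ := h'
  refine ⟨.union a b, ⟨ha, hb⟩, fun G => ?_⟩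
  ext ⟨m, n⟩
  simp only [eval, ha', hb', Set.mem_ofPred_eq, Set.mem_union]
  grind

theorem NodeDef.compl {F : Set Feature} (hF : Feature.coproj ∈ F) {Q : Graph Λ → Set ℕ}
    (h : NodeDef F Q) : NodeDef F fun G => NavGraph.adom G \ Q G := by
  obtain ⟨a, ha, ha'⟩ := h
  refine ⟨.coproj1 a, ⟨hF, ha⟩, fun G => ?_⟩
  ext ⟨m, n⟩
  simp only [eval, ha', Set.mem_ofPred_eq, Set.mem_sdiff]
  grind

theorem NodeDef.preimage {F : Set Feature} (hF : Feature.proj ∈ F) {Q : Graph Λ → Set ℕ}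
    (h : NodeDef F Q) {e : Expr Λ} (he : e.InFrag F) :
    NodeDef F fun G => {x | ∃ y ∈ Q G, (x, y) ∈ eval e G} := by
  obtain ⟨a, ha, ha'⟩ := h
  refine ⟨.proj1 (.comp e a), ⟨hF, he, ha⟩, fun G => ?_⟩
  have := @mem_adom_of_mem_eval Λ G e
  ext ⟨m, n⟩
  simp only [eval, ha', Set.mem_ofPred_eq]
  grind

theorem NodeDef.image {F : Set Feature} (hF : Feature.proj ∈ F) {Q : Graph Λ → Set ℕ}
    (h : NodeDef F Q) {e : Expr Λ} (he : e.InFrag F) :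
    NodeDef F fun G => {y | ∃ x ∈ Q G, (x, y) ∈ eval e G} := by
  obtain ⟨a, ha, ha'⟩ := h
  refine ⟨.proj2 (.comp a e), ⟨hF, ha, he⟩, fun G => ?_⟩
  have := @mem_adom_of_mem_eval Λ G e
  ext ⟨m, n⟩
  simp only [eval, ha', Set.mem_ofPred_eq]
  grind

/-- Images and preimages of definable node sets under relations that are defined without
intersection and difference are definable without converse. -/
theorem nodeDef_preimage_image {F F' : Set Feature} (hF : F \ {.conv} ⊆ F')
    (hi : Feature.inter ∉ F) (hd : Feature.diff ∉ F) (hp : Feature.proj ∈ F') (e : Expr Λ) :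
    e.InFrag F → ∀ Q : Graph Λ → Set ℕ, NodeDef F' Q →
      (NodeDef F' fun G => {x | ∃ y ∈ Q G, (x, y) ∈ eval e G}) ∧
      (NodeDef F' fun G => {y | ∃ x ∈ Q G, (x, y) ∈ eval e G}) := by
  induction e with
  | rel R => exact fun _ Q hQ => ⟨hQ.preimage hp (e := .rel R) trivial,
      hQ.image hp (e := .rel R) trivial⟩
  | empty => exact fun _ Q hQ => ⟨hQ.preimage hp (e := .empty) trivial,
      hQ.image hp (e := .empty) trivial⟩
  | id => exact fun _ Q hQ => ⟨hQ.preimage hp (e := .id) trivial,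
      hQ.image hp (e := .id) trivial⟩
  | comp e₁ e₂ ih₁ ih₂ =>
    intro h Q hQ
    refine ⟨(ih₁ h.1 _ (ih₂ h.2 Q hQ).1).1.congr fun G x => ?_,
      (ih₂ h.2 _ (ih₁ h.1 Q hQ).2).2.congr fun G x => ?_⟩ <;>
    simp only [eval, Set.mem_ofPred_eq] <;> grind
  | union e₁ e₂ ih₁ ih₂ =>
    intro h Q hQ
    refine ⟨((ih₁ h.1 Q hQ).1.union (ih₂ h.2 Q hQ).1).congr fun G x => ?_,
      ((ih₁ h.1 Q hQ).2.union (ih₂ h.2 Q hQ).2).congr fun G x => ?_⟩ <;>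
    simp only [eval, Set.mem_ofPred_eq, Set.mem_union] <;> grind
  | di =>
    intro h Q hQ
    have h' : Expr.InFrag (Λ := Λ) F' .di := hF ⟨h, by simp⟩
    exact ⟨hQ.preimage hp h', hQ.image hp h'⟩
  | conv e ih => exact fun h Q hQ => (ih h.2 Q hQ).symm
  | inter e₁ e₂ => exact fun h => (hi h.1).elim
  | diff e₁ e₂ => exact fun h => (hd h.1).elim
  | proj1 e ih =>
    intro h Q hQ
    have h' := (ih h.2 _ (NodeDef.adom F')).1.inter hQ
    have := fun G => @mem_adom_of_mem_eval Λ G e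
    refine ⟨h'.congr fun G x => ?_, h'.congr fun G x => ?_⟩ <;>
    simp only [eval, Set.mem_ofPred_eq, Set.mem_inter_iff] <;> grind
  | proj2 e ih =>
    intro h Q hQ
    have h' := (ih h.2 _ (NodeDef.adom F')).2.inter hQ
    have := fun G => @mem_adom_of_mem_eval Λ G e
    refine ⟨h'.congr fun G x => ?_, h'.congr fun G x => ?_⟩ <;>
    simp only [eval, Set.mem_ofPred_eq, Set.mem_inter_iff] <;> grind
  | coproj1 e ih =>
    intro h Q hQ
    have h' := ((ih h.2 _ (NodeDef.adom F')).1.compl (hF ⟨h.1, by simp⟩)).inter hQ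
    have := fun G => @mem_adom_of_mem_eval Λ G e
    refine ⟨h'.congr fun G x => ?_, h'.congr fun G x => ?_⟩ <;>
    simp only [eval, Set.mem_ofPred_eq, Set.mem_inter_iff, Set.mem_sdiff] <;> grind
  | coproj2 e ih =>
    intro h Q hQ
    have h' := ((ih h.2 _ (NodeDef.adom F')).2.compl (hF ⟨h.1, by simp⟩)).inter hQ
    have := fun G => @mem_adom_of_mem_eval Λ G e
    refine ⟨h'.congr fun G x => ?_, h'.congr fun G x => ?_⟩ <;>
    simp only [eval, Set.mem_ofPred_eq, Set.mem_inter_iff, Set.mem_sdiff] <;> grind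

theorem leqBool_diff_conv_union_proj {F : Set Feature}
    (hi : Feature.inter ∉ F) (hd : Feature.diff ∉ F) :
    leqBool Λ F ((F \ {.conv}) ∪ {.proj}) := by
  intro e he
  obtain ⟨a, ha, ha'⟩ := (nodeDef_preimage_image (F' := (F \ {.conv}) ∪ {.proj})
    Set.subset_union_left hi hd (by simp) e he _ (NodeDef.adom _)).1
  refine ⟨a, ha, fun G => ?_⟩
  rw [ha']
  constructor
  · rintro ⟨⟨x, _⟩, -, y, -, h⟩
    exact ⟨_, h⟩
  · rintro ⟨⟨x, y⟩, h⟩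
    exact ⟨(x, x), rfl, y, (mem_adom_of_mem_eval e h).2, h⟩

theorem leqBool_tilde (F : Set Feature) : leqBool Λ F (tilde F) := by
  unfold tilde
  split_ifs with h
  · exact leqBool_diff_conv_union_proj (fun h' => h.2 (.base h'))
      (fun h' => h.2 (.inter_of_diff (.base h')))
  · exact leqBool_of_subset fun x hx => .base hx

end Converse

section UniformGraphs

variable {Λ : Type}

/-- The graph in which every label is interpreted by the relation `r`. -/
def uniform (Λ : Type) (r : Set (ℕ × ℕ)) : Graph Λ := fun _ => r

theorem mem_adom_uniform [Nonempty Λ] {r : Set (ℕ × ℕ)} {m : ℕ} :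
    m ∈ adom (uniform Λ r) ↔ ∃ n, (m, n) ∈ r ∨ (n, m) ∈ r := by
  simp [adom, uniform]

/-- The relation consisting of the pairs in a list. -/
def listRel (l : List (ℕ × ℕ)) : Set (ℕ × ℕ) := {p | p ∈ l}

@[simp]
theorem mem_listRel {l : List (ℕ × ℕ)} {p : ℕ × ℕ} : p ∈ listRel l ↔ p ∈ l := Iff.rfl

/-- The nodes occurring in a list of edges. -/
def nodes (l : List (ℕ × ℕ)) : List ℕ := l.map Prod.fst ++ l.map Prod.snd

theorem mem_adom_listRel [Nonempty Λ] {l : List (ℕ × ℕ)} {m : ℕ} :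
    m ∈ adom (uniform Λ (listRel l)) ↔ m ∈ nodes l := by
  simp [mem_adom_uniform, nodes, exists_or]

theorem eval_id_listRel [Nonempty Λ] (l : List (ℕ × ℕ)) :
    eval .id (uniform Λ (listRel l)) = listRel ((nodes l).map fun m => (m, m)) := by
  ext ⟨m, n⟩
  simp only [eval, Set.mem_ofPred_eq, mem_adom_listRel, mem_listRel, List.mem_map,
    Prod.mk.injEq]
  grind

theorem eval_di_listRel [Nonempty Λ] (l : List (ℕ × ℕ)) :
    eval .di (uniform Λ (listRel l)) =
      listRel ((nodes l ×ˢ nodes l).filter fun p => p.1 ≠ p.2) := by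
  ext ⟨m, n⟩
  simp [eval, mem_adom_listRel, and_assoc]

theorem eval_conv_listRel (l : List (ℕ × ℕ)) (R : Λ) :
    eval (.conv (.rel R)) (uniform Λ (listRel l)) = listRel (l.map Prod.swap) := by
  ext ⟨m, n⟩
  simp [eval, uniform]

/-- The query asking for a node with an ingoing edge, an outgoing path of length two, and an edge
to a node in which a path of length three ends. -/
def tripodQuery (R : Λ) : Expr Λ :=
  .comp (.rel R) (.comp (.proj1 (.comp (.rel R) (.rel R)))
    (.comp (.rel R) (.proj2 (.comp (.rel R) (.comp (.rel R) (.rel R))))))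

/-- The query `R³ ∘ R⁻¹ ∘ R²`. -/
def zigzagQuery (R : Λ) : Expr Λ :=
  .comp (.comp (.rel R) (.comp (.rel R) (.rel R)))
    (.comp (.conv (.rel R)) (.comp (.rel R) (.rel R)))

/-- A tree with three legs, satisfying both `tripodQuery` and `zigzagQuery`. -/
def tripod : List (ℕ × ℕ) := [(0, 1), (1, 2), (2, 3), (1, 4), (5, 4), (6, 5), (7, 6)]

/-- A directed path of length three. -/
def path3 : List (ℕ × ℕ) := [(0, 1), (1, 2), (2, 3)]

/-- A graph on which `tripodQuery` fails, although every walk in `tripod` can be imitated in it. -/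
def fence : List (ℕ × ℕ) := [(0, 2), (0, 3), (0, 4), (1, 2), (2, 3), (3, 4), (3, 5)]

theorem tripodQuery_tripod (R : Λ) :
    (eval (tripodQuery R) (uniform Λ (listRel tripod))).Nonempty := by
  have h : ∀ p ∈ tripod, p ∈ uniform Λ (listRel tripod) R := fun _ h => h
  refine ⟨(0, 4), 1, h (0, 1) (by decide), 1, ⟨rfl, ⟨0, R, .inr (h (0, 1) (by decide))⟩, 3, 2,
    h (1, 2) (by decide), h (2, 3) (by decide)⟩, 4, h (1, 4) (by decide), rfl,
    ⟨1, R, .inr (h (1, 4) (by decide))⟩, 7, 6, h (7, 6) (by decide), 5, h (6, 5) (by decide),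
    h (5, 4) (by decide)⟩

theorem zigzagQuery_tripod (R : Λ) :
    (eval (zigzagQuery R) (uniform Λ (listRel tripod))).Nonempty := by
  have h : ∀ p ∈ tripod, p ∈ uniform Λ (listRel tripod) R := fun _ h => h
  exact ⟨(7, 3), 4, ⟨6, h (7, 6) (by decide), 5, h (6, 5) (by decide), h (5, 4) (by decide)⟩,
    1, h (1, 4) (by decide), 2, h (1, 2) (by decide), h (2, 3) (by decide)⟩

theorem not_tripodQuery {l : List (ℕ × ℕ)} (R : Λ)
    (hl : ∀ p ∈ l, ∀ q ∈ l, p.2 = q.1 → ∀ s ∈ l, q.2 = s.1 → ∀ t ∈ l, t.2 = s.2 →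
      ∀ a ∈ l, a.1 = t.1 → ∀ b ∈ l, a.2 = b.1 → ∀ c ∈ l, c.2 ≠ t.1) :
    ¬ (eval (tripodQuery R) (uniform Λ (listRel l))).Nonempty := by
  rintro ⟨⟨u, f'⟩, c, huc, c', ⟨hcc, -, e, d, hcd, hde⟩, f, hcf, hff, -, i, h, hih, g, hhg, hgf⟩
  obtain rfl : c = c' := hcc
  exact hl _ hih _ hhg rfl _ hgf rfl _ hcf rfl _ hcd rfl _ hde rfl _ huc rfl

theorem not_tripodQuery_path3 (R : Λ) :
    ¬ (eval (tripodQuery R) (uniform Λ (listRel path3))).Nonempty :=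
  not_tripodQuery R (by decide)

theorem not_tripodQuery_fence (R : Λ) :
    ¬ (eval (tripodQuery R) (uniform Λ (listRel fence))).Nonempty :=
  not_tripodQuery R (by decide)

theorem not_zigzagQuery_path3 (R : Λ) :
    ¬ (eval (zigzagQuery R) (uniform Λ (listRel path3))).Nonempty := by
  rintro ⟨⟨i, e⟩, f, ⟨h, hih, g, hhg, hgf⟩, c, hcf, d, hcd, hde⟩
  have : ∀ p ∈ path3, ∀ q ∈ path3, p.2 = q.1 → ∀ s ∈ path3, q.2 = s.1 →
      ∀ t ∈ path3, t.2 = s.2 → ∀ a ∈ path3, t.1 = a.1 → ∀ b ∈ path3, a.2 ≠ b.1 := by decide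
  exact this _ hih _ hhg rfl _ hgf rfl _ hcf rfl _ hcd rfl _ hde rfl

end UniformGraphs

section Walks

variable {Λ : Type}

/-- Every `A`-step of a node can be imitated by `B`-steps of the sets of nodes related to it. -/
def Imitates (I : ℕ → Set ℕ → Prop) (A B : Set (ℕ × ℕ)) : Prop :=
  ∀ x x' Y, I x Y → (x, x') ∈ A → ∃ Y', I x' Y' ∧ ∀ y' ∈ Y', ∃ y ∈ Y, (y, y') ∈ B

variable {I : ℕ → Set ℕ → Prop} {A A' B B' : Set (ℕ × ℕ)}

theorem Imitates.union (h : Imitates I A B) (h' : Imitates I A' B') :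
    Imitates I (A ∪ A') (B ∪ B') := by
  rintro x x' Y hY (hx | hx)
  · obtain ⟨Y', hY', hB⟩ := h x x' Y hY hx
    exact ⟨Y', hY', fun y' hy' => (hB y' hy').imp fun _ hy => ⟨hy.1, .inl hy.2⟩⟩
  · obtain ⟨Y', hY', hB⟩ := h' x x' Y hY hx
    exact ⟨Y', hY', fun y' hy' => (hB y' hy').imp fun _ hy => ⟨hy.1, .inr hy.2⟩⟩

theorem Imitates.comp (h : Imitates I A B) (h' : Imitates I A' B') :
    Imitates I {p | ∃ z, (p.1, z) ∈ A ∧ (z, p.2) ∈ A'}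
      {p | ∃ z, (p.1, z) ∈ B ∧ (z, p.2) ∈ B'} := by
  rintro x x' Y hY ⟨z, hxz, hzx⟩
  obtain ⟨Z, hZ, hB⟩ := h x z Y hY hxz
  obtain ⟨Y', hY', hB'⟩ := h' z x' Z hZ hzx
  refine ⟨Y', hY', fun y' hy' => ?_⟩
  obtain ⟨z', hz', hz''⟩ := hB' y' hy'
  obtain ⟨y, hy, hyz⟩ := hB z' hz'
  exact ⟨y, hy, z', hyz, hz''⟩

theorem imitates_eval {F : Set Feature} (hF : F ⊆ {.di, .conv}) {G₁ G₂ : Graph Λ}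
    (hI : ∀ x Y, I x Y → Y ⊆ adom G₂) (hrel : ∀ R, Imitates I (G₁ R) (G₂ R))
    (hconv : Feature.conv ∈ F →
      ∀ R, Imitates I (eval (.conv (.rel R)) G₁) (eval (.conv (.rel R)) G₂))
    (hdi : Feature.di ∈ F → Imitates I (eval .di G₁) (eval .di G₂)) (e : Expr Λ) :
    e.InFrag F → Imitates I (eval e G₁) (eval e G₂) ∧
      (Feature.conv ∈ F → Imitates I (eval (.conv e) G₁) (eval (.conv e) G₂)) := by
  induction e with
  | rel R => exact fun _ => ⟨hrel R, fun h => hconv h R⟩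
  | empty =>
    have : Imitates I (∅ : Set (ℕ × ℕ)) ∅ := fun _ _ _ _ h => h.elim
    exact fun _ => ⟨this, fun _ => this⟩
  | id =>
    refine fun _ => ⟨?_, fun _ => ?_⟩ <;>
    · rintro x x' Y hY ⟨h, -⟩
      obtain rfl : x = x' := by first | exact h | exact h.symm
      exact ⟨Y, hY, fun y hy => ⟨y, hy, rfl, hI x Y hY hy⟩⟩
  | comp e₁ e₂ ih₁ ih₂ =>
    rintro ⟨h₁, h₂⟩
    refine ⟨(ih₁ h₁).1.comp (ih₂ h₂).1, fun h => ?_⟩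
    convert ((ih₂ h₂).2 h).comp ((ih₁ h₁).2 h) using 1 <;>
    · ext p
      simp only [eval, Set.mem_ofPred_eq, and_comm]
  | union e₁ e₂ ih₁ ih₂ =>
    exact fun ⟨h₁, h₂⟩ => ⟨(ih₁ h₁).1.union (ih₂ h₂).1,
      fun h => ((ih₁ h₁).2 h).union ((ih₂ h₂).2 h)⟩
  | di =>
    refine fun h => ⟨hdi h, fun _ => ?_⟩
    convert hdi h using 1 <;>
    · ext p
      simp only [eval, Set.mem_ofPred_eq]
      grind
  | conv e ih => exact fun h => ⟨(ih h.2).2 h.1, fun _ => (ih h.2).1⟩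
  | inter | diff | proj1 | proj2 | coproj1 | coproj2 => exact fun h => by simpa using hF h.1

/-- The relation between nodes and sets of nodes given by a list. -/
def listState (s : List (ℕ × List ℕ)) (x : ℕ) (Y : Set ℕ) : Prop :=
  ∃ t ∈ s, t.1 = x ∧ Y = {y | y ∈ t.2}

theorem imitates_listRel {s : List (ℕ × List ℕ)} {a b : List (ℕ × ℕ)}
    (h : ∀ t ∈ s, ∀ p ∈ a, p.1 = t.1 →
      ∃ t' ∈ s, t'.1 = p.2 ∧ ∀ y' ∈ t'.2, ∃ y ∈ t.2, (y, y') ∈ b) :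
    Imitates (listState s) (listRel a) (listRel b) := by
  rintro x x' Y ⟨t, ht, rfl, rfl⟩ hx
  obtain ⟨t', ht', rfl, hb⟩ := h t ht _ hx rfl
  exact ⟨_, ⟨t', ht', rfl, rfl⟩, hb⟩

theorem eval_nonempty_of_listState [Nonempty Λ] {F : Set Feature} (hF : F ⊆ {.di, .conv})
    (s : List (ℕ × List ℕ)) (a b : List (ℕ × ℕ))
    (hs : ∀ t ∈ s, t.2 ≠ [] ∧ ∀ y ∈ t.2, y ∈ nodes b) (hstart : ∀ x ∈ nodes a, ∃ t ∈ s, t.1 = x)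
    (hrel : Imitates (listState s) (listRel a) (listRel b))
    (hconv : Feature.conv ∈ F →
      Imitates (listState s) (listRel (a.map Prod.swap)) (listRel (b.map Prod.swap)))
    (hdi : Imitates (listState s) (listRel ((nodes a ×ˢ nodes a).filter fun p => p.1 ≠ p.2))
      (listRel ((nodes b ×ˢ nodes b).filter fun p => p.1 ≠ p.2)))
    {e : Expr Λ} (he : e.InFrag F) (h : (eval e (uniform Λ (listRel a))).Nonempty) :
    (eval e (uniform Λ (listRel b))).Nonempty := by
  obtain ⟨⟨x, x'⟩, hx⟩ := h
  obtain ⟨t, ht, rfl⟩ := hstart x (mem_adom_listRel.1 (mem_adom_of_mem_eval e hx).1)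
  have hI : ∀ x Y, listState s x Y → Y ⊆ adom (uniform Λ (listRel b)) := by
    rintro x Y ⟨t, ht, -, rfl⟩ y hy
    exact mem_adom_listRel.2 ((hs t ht).2 y hy)
  obtain ⟨Y', ⟨t', ht', -, rfl⟩, hY'⟩ := (imitates_eval (G₁ := uniform Λ (listRel a))
    (G₂ := uniform Λ (listRel b)) hF hI (fun _ => hrel)
    (fun h R => by rw [eval_conv_listRel, eval_conv_listRel]; exact hconv h)
    (fun _ => by rw [eval_di_listRel, eval_di_listRel]; exact hdi) e he).1 _ _ _
    ⟨t, ht, rfl, rfl⟩ hx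
  obtain ⟨y', hy'⟩ := List.exists_mem_of_ne_nil _ (hs t' ht').1
  obtain ⟨y, -, hy⟩ := hY' y' hy'
  exact ⟨_, hy⟩

theorem not_leqBool_of_proj_of_subset_di_conv [Nonempty Λ] {F₁ F₂ : Set Feature}
    (h₁ : Feature.proj ∈ F₁) (h₂ : F₂ ⊆ {.di, .conv}) : ¬ leqBool Λ F₁ F₂ := by
  intro h
  obtain ⟨R⟩ := ‹Nonempty Λ›
  obtain ⟨e, he, heq⟩ := h (tripodQuery R) (by simp [tripodQuery, Expr.InFrag, h₁])
  have : Nonempty Λ := ⟨R⟩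
  refine not_tripodQuery_fence R ((heq _).1 (eval_nonempty_of_listState h₂
    [(0, [0, 1]), (0, [0, 2]), (1, [0, 2]), (1, [0, 3]), (1, [2, 3, 4]), (2, [0, 3]),
      (2, [2, 3, 4]), (2, [3, 4, 5]), (3, [4, 5]), (4, [2, 3, 4]), (4, [4, 5]), (5, [0, 3]),
      (5, [2, 3, 4]), (5, [3, 4, 5]), (6, [0, 2]), (6, [2, 3, 4]), (7, [0, 1])]
    tripod fence (by decide) (by decide) (imitates_listRel (by decide))
    (fun _ => imitates_listRel (by decide)) (imitates_listRel (by decide +kernel)) he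
    ((heq _).2 (tripodQuery_tripod R))))

theorem not_leqBool_of_conv_of_subset_di [Nonempty Λ] {F₁ F₂ : Set Feature}
    (h₁ : Feature.conv ∈ F₁) (h₂ : F₂ ⊆ {.di}) : ¬ leqBool Λ F₁ F₂ := by
  intro h
  obtain ⟨R⟩ := ‹Nonempty Λ›
  obtain ⟨e, he, heq⟩ := h (zigzagQuery R) (by simp [zigzagQuery, Expr.InFrag, h₁])
  have : Nonempty Λ := ⟨R⟩
  refine not_zigzagQuery_path3 R ((heq _).1 (eval_nonempty_of_listState
    (h₂.trans (by simp))
    [(0, [0, 1, 2]), (1, [0, 1, 2]), (1, [1, 2, 3]), (2, [0, 1, 2]), (2, [2, 3]), (3, [0, 1, 2]),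
      (3, [3]), (4, [0, 1, 2]), (4, [3]), (5, [0, 1, 2]), (5, [2, 3]), (6, [0, 1, 2]),
      (6, [1, 2, 3]), (7, [0, 1, 2])]
    tripod path3 (by decide) (by decide) (imitates_listRel (by decide))
    (fun h => by simpa using h₂ h) (imitates_listRel (by decide +kernel)) he
    ((heq _).2 (zigzagQuery_tripod R))))

end Walks

section Atoms

variable {Λ K : Type}

/-- Composition of binary relations. -/
def relComp (A B : Set (ℕ × ℕ)) : Set (ℕ × ℕ) := {p | ∃ z, (p.1, z) ∈ A ∧ (z, p.2) ∈ B}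

/-- The converse of a binary relation. -/
def relConv (A : Set (ℕ × ℕ)) : Set (ℕ × ℕ) := {p | (p.2, p.1) ∈ A}

/-- The identity on the domain of a binary relation. -/
def relDom (A : Set (ℕ × ℕ)) : Set (ℕ × ℕ) := {p | p.1 = p.2 ∧ ∃ n, (p.1, n) ∈ A}

/-- The union of the members of a family of relations with index in `S`. -/
def atomUnion (D : K → Set (ℕ × ℕ)) (S : Set K) : Set (ℕ × ℕ) := {p | ∃ k ∈ S, p ∈ D k}

/-- `A` and `B` are the unions of the members of two families with the same indices. -/
def Similar (D₁ D₂ : K → Set (ℕ × ℕ)) (A B : Set (ℕ × ℕ)) : Prop :=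
  ∃ S : Set K, A = atomUnion D₁ S ∧ B = atomUnion D₂ S

variable {D₁ D₂ : K → Set (ℕ × ℕ)} {A A' B B' : Set (ℕ × ℕ)}

theorem Similar.biUnion {ι : Type} (S : Set ι) {A B : ι → Set (ℕ × ℕ)}
    (h : ∀ i ∈ S, Similar D₁ D₂ (A i) (B i)) :
    Similar D₁ D₂ {p | ∃ i ∈ S, p ∈ A i} {p | ∃ i ∈ S, p ∈ B i} := by
  choose T hA hB using h
  refine ⟨{k | ∃ i, ∃ hi : i ∈ S, k ∈ T i hi}, ?_, ?_⟩
  · ext p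
    constructor
    · rintro ⟨i, hi, hp⟩
      rw [hA i hi] at hp
      obtain ⟨k, hk, hp⟩ := hp
      exact ⟨k, ⟨i, hi, hk⟩, hp⟩
    · rintro ⟨k, ⟨i, hi, hk⟩, hp⟩
      refine ⟨i, hi, ?_⟩
      rw [hA i hi]
      exact ⟨k, hk, hp⟩
  · ext p
    constructor
    · rintro ⟨i, hi, hp⟩
      rw [hB i hi] at hp
      obtain ⟨k, hk, hp⟩ := hp
      exact ⟨k, ⟨i, hi, hk⟩, hp⟩
    · rintro ⟨k, ⟨i, hi, hk⟩, hp⟩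
      refine ⟨i, hi, ?_⟩
      rw [hB i hi]
      exact ⟨k, hk, hp⟩

theorem Similar.union (h : Similar D₁ D₂ A B) (h' : Similar D₁ D₂ A' B') :
    Similar D₁ D₂ (A ∪ A') (B ∪ B') := by
  obtain ⟨S, rfl, rfl⟩ := h
  obtain ⟨T, rfl, rfl⟩ := h'
  refine ⟨S ∪ T, ?_, ?_⟩ <;>
  · ext p
    simp only [atomUnion, Set.mem_union, Set.mem_ofPred_eq, or_and_right, exists_or]

theorem Similar.diff (hD₁ : ∀ i j p, p ∈ D₁ i → p ∈ D₁ j → i = j)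
    (hD₂ : ∀ i j p, p ∈ D₂ i → p ∈ D₂ j → i = j)
    (h : Similar D₁ D₂ A B) (h' : Similar D₁ D₂ A' B') :
    Similar D₁ D₂ (A \ A') (B \ B') := by
  obtain ⟨S, rfl, rfl⟩ := h
  obtain ⟨T, rfl, rfl⟩ := h'
  refine ⟨S \ T, ?_, ?_⟩ <;>
  · ext p
    simp only [atomUnion, Set.mem_sdiff, Set.mem_ofPred_eq]
    grind

theorem Similar.inter (hD₁ : ∀ i j p, p ∈ D₁ i → p ∈ D₁ j → i = j)
    (hD₂ : ∀ i j p, p ∈ D₂ i → p ∈ D₂ j → i = j)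
    (h : Similar D₁ D₂ A B) (h' : Similar D₁ D₂ A' B') :
    Similar D₁ D₂ (A ∩ A') (B ∩ B') := by
  rw [← Set.sdiff_sdiff_right_self, ← Set.sdiff_sdiff_right_self]
  exact h.diff hD₁ hD₂ (h.diff hD₁ hD₂ h')

theorem Similar.comp
    (hcomp : ∀ i j, Similar D₁ D₂ (relComp (D₁ i) (D₁ j)) (relComp (D₂ i) (D₂ j)))
    (h : Similar D₁ D₂ A B) (h' : Similar D₁ D₂ A' B') :
    Similar D₁ D₂ (relComp A A') (relComp B B') := by
  obtain ⟨S, rfl, rfl⟩ := h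
  obtain ⟨T, rfl, rfl⟩ := h'
  convert Similar.biUnion (S ×ˢ T) fun i _ => hcomp i.1 i.2 using 1 <;>
  · ext p
    simp only [relComp, atomUnion, Set.mem_ofPred_eq, Set.mem_prod, Prod.exists]
    grind

theorem Similar.conv (hconv : ∀ i, Similar D₁ D₂ (relConv (D₁ i)) (relConv (D₂ i)))
    (h : Similar D₁ D₂ A B) : Similar D₁ D₂ (relConv A) (relConv B) := by
  obtain ⟨S, rfl, rfl⟩ := h
  exact Similar.biUnion S fun i _ => hconv i

theorem Similar.dom (hdom : ∀ i, Similar D₁ D₂ (relDom (D₁ i)) (relDom (D₂ i)))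
    (h : Similar D₁ D₂ A B) : Similar D₁ D₂ (relDom A) (relDom B) := by
  obtain ⟨S, rfl, rfl⟩ := h
  convert Similar.biUnion S fun i _ => hdom i using 1 <;>
  · ext p
    simp only [relDom, atomUnion, Set.mem_ofPred_eq]
    grind

theorem Similar.ran
    (hran : ∀ i, Similar D₁ D₂ (relDom (relConv (D₁ i))) (relDom (relConv (D₂ i))))
    (h : Similar D₁ D₂ A B) : Similar D₁ D₂ (relDom (relConv A)) (relDom (relConv B)) := by
  obtain ⟨S, rfl, rfl⟩ := h
  convert Similar.biUnion S fun i _ => hran i using 1 <;>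
  · ext p
    simp only [relDom, relConv, atomUnion, Set.mem_ofPred_eq]
    grind

theorem eval_proj1 (e : Expr Λ) (G : Graph Λ) : eval (.proj1 e) G = relDom (eval e G) := by
  have := @mem_adom_of_mem_eval Λ G e
  ext ⟨m, n⟩
  simp only [eval, relDom, Set.mem_ofPred_eq]
  grind

theorem eval_proj2 (e : Expr Λ) (G : Graph Λ) :
    eval (.proj2 e) G = relDom (relConv (eval e G)) := by
  have := @mem_adom_of_mem_eval Λ G e
  ext ⟨m, n⟩
  simp only [eval, relDom, relConv, Set.mem_ofPred_eq]
  grind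

theorem eval_coproj1 (e : Expr Λ) (G : Graph Λ) :
    eval (.coproj1 e) G = eval .id G \ relDom (eval e G) := by
  ext ⟨m, n⟩
  simp only [eval, relDom, Set.mem_ofPred_eq, Set.mem_sdiff]
  grind

theorem eval_coproj2 (e : Expr Λ) (G : Graph Λ) :
    eval (.coproj2 e) G = eval .id G \ relDom (relConv (eval e G)) := by
  ext ⟨m, n⟩
  simp only [eval, relDom, relConv, Set.mem_ofPred_eq, Set.mem_sdiff]
  grind

/-- If the atoms of two graphs satisfy the same composition laws, then every expression evaluates
to corresponding unions of atoms. -/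
theorem similar_eval {F : Set Feature} {G₁ G₂ : Graph Λ}
    (hD₁ : ∀ i j p, p ∈ D₁ i → p ∈ D₁ j → i = j)
    (hD₂ : ∀ i j p, p ∈ D₂ i → p ∈ D₂ j → i = j)
    (hrel : ∀ R, Similar D₁ D₂ (G₁ R) (G₂ R))
    (hid : Similar D₁ D₂ (eval .id G₁) (eval .id G₂))
    (hcomp : ∀ i j, Similar D₁ D₂ (relComp (D₁ i) (D₁ j)) (relComp (D₂ i) (D₂ j)))
    (hdi : Feature.di ∈ F → Similar D₁ D₂ (eval .di G₁) (eval .di G₂))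
    (hconv : Feature.conv ∈ F → ∀ i, Similar D₁ D₂ (relConv (D₁ i)) (relConv (D₂ i)))
    (hproj : Feature.proj ∈ F ∨ Feature.coproj ∈ F → ∀ i,
      Similar D₁ D₂ (relDom (D₁ i)) (relDom (D₂ i)) ∧
      Similar D₁ D₂ (relDom (relConv (D₁ i))) (relDom (relConv (D₂ i))))
    (e : Expr Λ) : e.InFrag F → Similar D₁ D₂ (eval e G₁) (eval e G₂) := by
  induction e with
  | rel R => exact fun _ => hrel R
  | empty => exact fun _ => ⟨∅, by simp [eval, atomUnion], by simp [eval, atomUnion]⟩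
  | id => exact fun _ => hid
  | comp e₁ e₂ ih₁ ih₂ => exact fun h => (ih₁ h.1).comp hcomp (ih₂ h.2)
  | union e₁ e₂ ih₁ ih₂ => exact fun h => (ih₁ h.1).union (ih₂ h.2)
  | di => exact hdi
  | conv e ih => exact fun h => (ih h.2).conv (hconv h.1)
  | inter e₁ e₂ ih₁ ih₂ => exact fun h => (ih₁ h.2.1).inter hD₁ hD₂ (ih₂ h.2.2)
  | diff e₁ e₂ ih₁ ih₂ => exact fun h => (ih₁ h.2.1).diff hD₁ hD₂ (ih₂ h.2.2)
  | proj1 e ih =>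
    intro h
    rw [eval_proj1, eval_proj1]
    exact (ih h.2).dom fun i => (hproj (.inl h.1) i).1
  | proj2 e ih =>
    intro h
    rw [eval_proj2, eval_proj2]
    exact (ih h.2).ran fun i => (hproj (.inl h.1) i).2
  | coproj1 e ih =>
    intro h
    rw [eval_coproj1, eval_coproj1]
    exact hid.diff hD₁ hD₂ ((ih h.2).dom fun i => (hproj (.inr h.1) i).1)
  | coproj2 e ih =>
    intro h
    rw [eval_coproj2, eval_coproj2]
    exact hid.diff hD₁ hD₂ ((ih h.2).ran fun i => (hproj (.inr h.1) i).2)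

theorem Similar.nonempty_iff (hD : ∀ k, (D₁ k).Nonempty ∧ (D₂ k).Nonempty)
    (h : Similar D₁ D₂ A B) : A.Nonempty ↔ B.Nonempty := by
  obtain ⟨S, rfl, rfl⟩ := h
  constructor
  · rintro ⟨-, k, hk, -⟩
    exact ⟨_, k, hk, (hD k).2.some_mem⟩
  · rintro ⟨-, k, hk, -⟩
    exact ⟨_, k, hk, (hD k).1.some_mem⟩

theorem similar_listRel {l₁ l₂ : K → List (ℕ × ℕ)} {a b : List (ℕ × ℕ)} (S : List K)
    (ha : (∀ p ∈ a, ∃ k ∈ S, p ∈ l₁ k) ∧ ∀ k ∈ S, ∀ p ∈ l₁ k, p ∈ a)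
    (hb : (∀ p ∈ b, ∃ k ∈ S, p ∈ l₂ k) ∧ ∀ k ∈ S, ∀ p ∈ l₂ k, p ∈ b) :
    Similar (fun k => listRel (l₁ k)) (fun k => listRel (l₂ k)) (listRel a) (listRel b) :=
  ⟨{k | k ∈ S}, Set.ext fun p => ⟨ha.1 p, fun ⟨k, hk, hp⟩ => ha.2 k hk p hp⟩,
    Set.ext fun p => ⟨hb.1 p, fun ⟨k, hk, hp⟩ => hb.2 k hk p hp⟩⟩

/-- Composition of relations given by lists. -/
def listComp (a b : List (ℕ × ℕ)) : List (ℕ × ℕ) :=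
  a.flatMap fun p => (b.filter fun q => p.2 = q.1).map fun q => (p.1, q.2)

theorem relComp_listRel (a b : List (ℕ × ℕ)) :
    relComp (listRel a) (listRel b) = listRel (listComp a b) := by
  ext ⟨m, n⟩
  simp only [relComp, Set.mem_ofPred_eq, mem_listRel, listComp, List.mem_flatMap, List.mem_map,
    List.mem_filter, decide_eq_true_eq, Prod.mk.injEq, Prod.exists]
  grind

/-- The pairs of nodes of `tripod` joined by a path of length `k`. -/
def tripodDist : Fin 4 → List (ℕ × ℕ) :=
  ![(nodes tripod).map fun m => (m, m), tripod, listComp tripod tripod,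
    listComp tripod (listComp tripod tripod)]

/-- The pairs of nodes of `path3` joined by a path of length `k`. -/
def path3Dist : Fin 4 → List (ℕ × ℕ) :=
  ![(nodes path3).map fun m => (m, m), path3, listComp path3 path3,
    listComp path3 (listComp path3 path3)]

theorem eval_tripod_iff_path3 [Nonempty Λ] {F : Set Feature} (hF : F ⊆ {.inter, .diff})
    {e : Expr Λ} (he : e.InFrag F) : (eval e (uniform Λ (listRel tripod))).Nonempty ↔
      (eval e (uniform Λ (listRel path3))).Nonempty := by
  refine Similar.nonempty_iff (D₁ := fun k => listRel (tripodDist k))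
    (D₂ := fun k => listRel (path3Dist k)) ?_ (similar_eval ?_ ?_ ?_ ?_ ?_ ?_ ?_ ?_ e he)
  · have : ∀ k, tripodDist k ≠ [] ∧ path3Dist k ≠ [] := by decide
    exact fun k => ⟨List.exists_mem_of_ne_nil _ (this k).1, List.exists_mem_of_ne_nil _ (this k).2⟩
  · have : ∀ i j, ∀ p ∈ tripodDist i, p ∈ tripodDist j → i = j := by decide
    exact fun i j p => this i j p
  · have : ∀ i j, ∀ p ∈ path3Dist i, p ∈ path3Dist j → i = j := by decide
    exact fun i j p => this i j p
  · exact fun _ => similar_listRel [1] (by decide) (by decide)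
  · rw [eval_id_listRel, eval_id_listRel]
    exact similar_listRel [0] (by decide) (by decide)
  · intro i j
    rw [relComp_listRel, relComp_listRel]
    refine similar_listRel ((List.finRange 4).filter fun k => k.val = i.val + j.val) ?_ ?_ <;>
    · revert i j
      decide +kernel
  · exact fun h => by simpa using hF h
  · exact fun h => by simpa using hF h
  · rintro (h | h) <;> simpa using hF h

theorem not_leqBool_of_proj_of_subset_inter_diff [Nonempty Λ] {F₁ F₂ : Set Feature}
    (h₁ : Feature.proj ∈ F₁) (h₂ : F₂ ⊆ {.inter, .diff}) : ¬ leqBool Λ F₁ F₂ := by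
  intro h
  let R : Λ := Classical.arbitrary Λ
  obtain ⟨e, he, heq⟩ := h (tripodQuery R) (by simp [tripodQuery, Expr.InFrag, h₁])
  exact not_tripodQuery_path3 R ((heq _).1 ((eval_tripod_iff_path3 h₂ he).1
    ((heq _).2 (tripodQuery_tripod R))))

theorem not_leqBool_of_conv_of_subset_inter_diff [Nonempty Λ] {F₁ F₂ : Set Feature}
    (h₁ : Feature.conv ∈ F₁) (h₂ : F₂ ⊆ {.inter, .diff}) : ¬ leqBool Λ F₁ F₂ := by
  intro h
  let R : Λ := Classical.arbitrary Λ
  obtain ⟨e, he, heq⟩ := h (zigzagQuery R) (by simp [zigzagQuery, Expr.InFrag, h₁])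
  exact not_zigzagQuery_path3 R ((heq _).1 ((eval_tripod_iff_path3 h₂ he).1
    ((heq _).2 (zigzagQuery_tripod R))))

theorem eval_loop_iff_two_loops [Nonempty Λ] {F : Set Feature} (hF : Feature.di ∉ F)
    {e : Expr Λ} (he : e.InFrag F) : (eval e (uniform Λ (listRel [(0, 0)]))).Nonempty ↔
      (eval e (uniform Λ (listRel [(0, 0), (1, 1)]))).Nonempty := by
  have key : ∀ {A B : Set (ℕ × ℕ)}, A = listRel [(0, 0)] → B = listRel [(0, 0), (1, 1)] →
      Similar (fun _ : Unit => listRel [(0, 0)]) (fun _ => listRel [(0, 0), (1, 1)]) A B := by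
    rintro A B rfl rfl
    exact similar_listRel [()] (by decide) (by decide)
  refine Similar.nonempty_iff (fun _ => ⟨⟨(0, 0), by simp⟩, ⟨(0, 0), by simp⟩⟩)
    (similar_eval (G₁ := uniform Λ (listRel [(0, 0)]))
      (G₂ := uniform Λ (listRel [(0, 0), (1, 1)])) (fun _ _ _ _ _ => rfl)
      (fun _ _ _ _ _ => rfl) (fun _ => key rfl rfl) ?_ ?_ (fun h => (hF h).elim) ?_ ?_ e he)
  · rw [eval_id_listRel, eval_id_listRel]
    exact similar_listRel [()] (by decide) (by decide)
  · intro i j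
    rw [relComp_listRel, relComp_listRel]
    exact similar_listRel [()] (by decide) (by decide)
  · refine fun _ _ => key ?_ ?_ <;>
    · ext ⟨m, n⟩
      simp only [relConv, Set.mem_ofPred_eq, mem_listRel, List.mem_cons, Prod.mk.injEq,
        List.not_mem_nil]
      grind
  · refine fun _ _ => ⟨key ?_ ?_, key ?_ ?_⟩ <;>
    · ext ⟨m, n⟩
      simp only [relConv, relDom, Set.mem_ofPred_eq, mem_listRel, List.mem_cons, Prod.mk.injEq,
        List.not_mem_nil]
      grind

theorem not_leqBool_of_di [Nonempty Λ] {F₁ F₂ : Set Feature}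
    (h₁ : Feature.di ∈ F₁) (h₂ : Feature.di ∉ F₂) : ¬ leqBool Λ F₁ F₂ := by
  intro h
  obtain ⟨e, he, heq⟩ := h .di h₁
  have h' : (eval .di (uniform Λ (listRel [(0, 0), (1, 1)]))).Nonempty := by
    rw [eval_di_listRel]
    exact ⟨(0, 1), mem_listRel.2 (by decide)⟩
  have := (heq _).1 ((eval_loop_iff_two_loops h₂ he).2 ((heq _).2 h'))
  rw [eval_di_listRel] at this
  obtain ⟨p, hp⟩ := this
  simp [nodes] at hp

/-- The colour of `x` in the cyclic group of order 13 with connection set `A`. -/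
def color (A : List ℕ) (x : ℕ) : Fin 3 := if x = 0 then 0 else if x ∈ A then 1 else 2

/-- The pairs of elements of the cyclic group of order 13 whose difference has colour `k`. -/
def cyclicAtom (A : List ℕ) (k : Fin 3) : Set (ℕ × ℕ) :=
  {p | p.1 < 13 ∧ p.2 < 13 ∧ color A ((p.2 + 13 - p.1) % 13) = k}

/-- The composition of colours other than `0` is as large as possible. -/
def Ample (A : List ℕ) : Prop :=
  ∀ i j : Fin 3, i ≠ 0 → j ≠ 0 → ∀ m < 13, ∀ n < 13, ∃ z < 13,
    color A ((z + 13 - m) % 13) = i ∧ color A ((n + 13 - z) % 13) = j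

theorem Ample.exists_right {A : List ℕ} (hA : Ample A) (k : Fin 3) {m : ℕ} (hm : m < 13) :
    ∃ n, (m, n) ∈ cyclicAtom A k := by
  by_cases hk : k = 0
  · refine ⟨m, hm, hm, ?_⟩
    simp [color, hk]
  · obtain ⟨z, hz, h, -⟩ := hA k k hk hk m hm m hm
    exact ⟨z, hm, hz, h⟩

theorem Ample.exists_left {A : List ℕ} (hA : Ample A) (k : Fin 3) {m : ℕ} (hm : m < 13) :
    ∃ n, (n, m) ∈ cyclicAtom A k := by
  by_cases hk : k = 0
  · refine ⟨m, hm, hm, ?_⟩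
    simp [color, hk]
  · obtain ⟨z, hz, -, h⟩ := hA k k hk hk m hm m hm
    exact ⟨z, hz, hm, h⟩

theorem cyclicAtom_zero (A : List ℕ) : cyclicAtom A 0 = {p | p.1 = p.2 ∧ p.1 < 13} := by
  ext ⟨m, n⟩
  simp only [cyclicAtom, color, Set.mem_ofPred_eq]
  constructor
  · rintro ⟨hm, hn, h⟩
    split_ifs at h
    · exact ⟨by omega, hm⟩
    all_goals simp at h
  · rintro ⟨rfl, hm⟩
    simp [hm]

theorem Ample.relComp_cyclicAtom {A : List ℕ} (hA : Ample A) (i j : Fin 3) :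
    relComp (cyclicAtom A i) (cyclicAtom A j) =
      atomUnion (cyclicAtom A) (if i = 0 then {j} else if j = 0 then {i} else Set.univ) := by
  ext ⟨m, n⟩
  split_ifs with hi hj
  · subst hi
    rw [cyclicAtom_zero]
    constructor
    · rintro ⟨z, ⟨h, -⟩, h'⟩
      obtain rfl : m = z := h
      exact ⟨j, rfl, h'⟩
    · rintro ⟨_, rfl, h⟩
      exact ⟨m, ⟨rfl, h.1⟩, h⟩
  · subst hj
    rw [cyclicAtom_zero]
    constructor
    · rintro ⟨z, h, ⟨h', -⟩⟩
      obtain rfl : z = n := h'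
      exact ⟨i, rfl, h⟩
    · rintro ⟨_, rfl, h⟩
      exact ⟨n, h, ⟨rfl, h.2.1⟩⟩
  · constructor
    · rintro ⟨z, h, h'⟩
      exact ⟨_, trivial, h.1, h'.2.1, rfl⟩
    · rintro ⟨k, -, hm, hn, -⟩
      obtain ⟨z, hz, h, h'⟩ := hA i j hi hj m hm n hn
      exact ⟨z, ⟨hm, hz, h⟩, ⟨hz, hn, h'⟩⟩

theorem Ample.adom_cyclicAtom [Nonempty Λ] {A : List ℕ} (hA : Ample A) :
    adom (uniform Λ (cyclicAtom A 1)) = {m | m < 13} := by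
  ext m
  rw [mem_adom_uniform]
  constructor
  · rintro ⟨n, h | h⟩
    exacts [h.1, h.2.1]
  · exact fun hm => (hA.exists_right 1 hm).imp fun _ => .inl

theorem Ample.eval_id [Nonempty Λ] {A : List ℕ} (hA : Ample A) :
    eval .id (uniform Λ (cyclicAtom A 1)) = atomUnion (cyclicAtom A) {0} := by
  ext p
  simp [eval, hA.adom_cyclicAtom, atomUnion, cyclicAtom_zero]

theorem Ample.eval_di [Nonempty Λ] {A : List ℕ} (hA : Ample A) :
    eval .di (uniform Λ (cyclicAtom A 1)) = atomUnion (cyclicAtom A) {0}ᶜ := by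
  ext ⟨m, n⟩
  simp only [eval, hA.adom_cyclicAtom, atomUnion, Set.mem_ofPred_eq]
  constructor
  · rintro ⟨hm, hn, h⟩
    refine ⟨_, fun h' => h ?_, hm, hn, rfl⟩
    have : (m, n) ∈ cyclicAtom A 0 := ⟨hm, hn, h'⟩
    rw [cyclicAtom_zero] at this
    exact this.1
  · rintro ⟨k, hk, hm, hn, h⟩
    refine ⟨hm, hn, ?_⟩
    rintro rfl
    exact hk (h.symm.trans (by simp [color]))

theorem Ample.relDom_cyclicAtom {A : List ℕ} (hA : Ample A) (k : Fin 3) :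
    relDom (cyclicAtom A k) = atomUnion (cyclicAtom A) {0} := by
  ext ⟨m, n⟩
  simp only [atomUnion, relDom, Set.mem_ofPred_eq, Set.mem_singleton_iff, exists_eq_left,
    cyclicAtom_zero]
  exact and_congr_right fun _ => ⟨fun ⟨_, h⟩ => h.1, hA.exists_right k⟩

theorem Ample.relDom_relConv_cyclicAtom {A : List ℕ} (hA : Ample A) (k : Fin 3) :
    relDom (relConv (cyclicAtom A k)) = atomUnion (cyclicAtom A) {0} := by
  ext ⟨m, n⟩
  simp only [atomUnion, relDom, relConv, Set.mem_ofPred_eq, Set.mem_singleton_iff,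
    exists_eq_left, cyclicAtom_zero]
  exact and_congr_right fun _ => ⟨fun ⟨_, h⟩ => h.2.1, hA.exists_left k⟩

theorem cyclicAtom_disjoint (A : List ℕ) (i j : Fin 3) (p : ℕ × ℕ) (hi : p ∈ cyclicAtom A i)
    (hj : p ∈ cyclicAtom A j) : i = j :=
  hi.2.2.symm.trans hj.2.2

theorem Ample.eval_nonempty_iff [Nonempty Λ] {A B : List ℕ} (hA : Ample A) (hB : Ample B)
    {F : Set Feature} (hF : Feature.conv ∉ F) {e : Expr Λ} (he : e.InFrag F) :
    (eval e (uniform Λ (cyclicAtom A 1))).Nonempty ↔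
      (eval e (uniform Λ (cyclicAtom B 1))).Nonempty := by
  refine Similar.nonempty_iff (D₁ := cyclicAtom A) (D₂ := cyclicAtom B) (fun k =>
    ⟨(hA.exists_right k (m := 0) (by simp)).imp' _ fun _ h => h,
      (hB.exists_right k (m := 0) (by simp)).imp' _ fun _ h => h⟩)
    (similar_eval (cyclicAtom_disjoint A) (cyclicAtom_disjoint B)
      (fun _ => ⟨{1}, by simp [uniform, atomUnion], by simp [uniform, atomUnion]⟩)
      ⟨_, hA.eval_id, hB.eval_id⟩
      (fun i j => ⟨_, hA.relComp_cyclicAtom i j, hB.relComp_cyclicAtom i j⟩)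
      (fun _ => ⟨_, hA.eval_di, hB.eval_di⟩) (fun h => (hF h).elim)
      (fun _ k => ⟨⟨_, hA.relDom_cyclicAtom k, hB.relDom_cyclicAtom k⟩,
        ⟨_, hA.relDom_relConv_cyclicAtom k, hB.relDom_relConv_cyclicAtom k⟩⟩) e he)

theorem not_leqBool_of_conv_of_inter [Nonempty Λ] {F₁ F₂ : Set Feature}
    (h₁ : Feature.conv ∈ F₁) (h₁' : Feature.inter ∈ F₁) (h₂ : Feature.conv ∉ F₂) :
    ¬ leqBool Λ F₁ F₂ := by
  intro h
  let R : Λ := Classical.arbitrary Λ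
  let s : Expr Λ := .inter (.rel R) (.conv (.rel R))
  obtain ⟨e, he, heq⟩ := h (.inter (.comp s s) s) (by simp [s, Expr.InFrag, h₁, h₁'])
  have hA : Ample [1, 2, 4, 5, 8, 9] := by unfold Ample; decide +kernel
  have hB : Ample [1, 2, 4, 5, 6, 8] := by unfold Ample; decide +kernel
  have key : ∀ A : List ℕ, ∀ m n, (m, n) ∈ eval s (uniform Λ (cyclicAtom A 1)) ↔
      m < 13 ∧ n < 13 ∧ color A ((n + 13 - m) % 13) = 1 ∧ color A ((m + 13 - n) % 13) = 1 := by
    intro A m n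
    simp only [s, eval, uniform, cyclicAtom, Set.mem_inter_iff, Set.mem_ofPred_eq]
    tauto
  have hpos : (eval (.inter (.comp s s) s)
      (uniform Λ (cyclicAtom [1, 2, 4, 5, 8, 9] 1))).Nonempty :=
    ⟨(0, 8), ⟨4, (key _ _ _).2 (by decide), (key _ _ _).2 (by decide)⟩,
      (key _ _ _).2 (by decide)⟩
  obtain ⟨⟨m, n⟩, ⟨z, hmz, hzn⟩, hmn⟩ :=
    (heq _).1 ((hA.eval_nonempty_iff hB h₂ he).1 ((heq _).2 hpos))
  obtain ⟨hm, hz, hmz, hzm⟩ := (key _ _ _).1 hmz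
  obtain ⟨-, hn, hzn, hnz⟩ := (key _ _ _).1 hzn
  obtain ⟨-, -, hmn, hnm⟩ := (key _ _ _).1 hmn
  have : ∀ m < 13, ∀ z < 13, ∀ n < 13, ¬ (
      (color [1, 2, 4, 5, 6, 8] ((z + 13 - m) % 13) = 1 ∧
        color [1, 2, 4, 5, 6, 8] ((m + 13 - z) % 13) = 1) ∧
      (color [1, 2, 4, 5, 6, 8] ((n + 13 - z) % 13) = 1 ∧
        color [1, 2, 4, 5, 6, 8] ((z + 13 - n) % 13) = 1) ∧
      color [1, 2, 4, 5, 6, 8] ((n + 13 - m) % 13) = 1 ∧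
      color [1, 2, 4, 5, 6, 8] ((m + 13 - n) % 13) = 1) := by decide +kernel
  exact this m hm z hz n hn ⟨⟨hmz, hzm⟩, ⟨hzn, hnz⟩, hmn, hnm⟩

end Atoms

section Homogeneity

variable {Λ : Type}

/-- Every node of `V` has an outgoing and an ingoing `A`-edge. -/
def TotalOn (V : Set ℕ) (A : Set (ℕ × ℕ)) : Prop :=
  ∀ m ∈ V, (∃ n, (m, n) ∈ A) ∧ ∃ n, (n, m) ∈ A

theorem eval_empty_or_totalOn {F : Set Feature} (hi : Feature.inter ∉ F)
    (hd : Feature.diff ∉ F) {V : Set ℕ} {G₁ G₂ : Graph Λ} (h₁ : adom G₁ = V)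
    (h₂ : adom G₂ = V)
    (hrel : ∀ R, TotalOn V (G₁ R) ∧ TotalOn V (G₂ R))
    (hdi : TotalOn V (eval .di G₁) ∧ TotalOn V (eval .di G₂)) (e : Expr Λ) :
    e.InFrag F → eval e G₁ = ∅ ∧ eval e G₂ = ∅ ∨
      TotalOn V (eval e G₁) ∧ TotalOn V (eval e G₂) := by
  have hid : TotalOn V (eval .id G₁) ∧ TotalOn V (eval .id G₂) :=
    ⟨fun m hm => ⟨⟨m, rfl, h₁ ▸ hm⟩, ⟨m, rfl, h₁ ▸ hm⟩⟩,
      fun m hm => ⟨⟨m, rfl, h₂ ▸ hm⟩, ⟨m, rfl, h₂ ▸ hm⟩⟩⟩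
  have hcomp : ∀ G : Graph Λ, adom G = V → ∀ e₁ e₂ : Expr Λ, TotalOn V (eval e₁ G) →
      TotalOn V (eval e₂ G) → TotalOn V (eval (.comp e₁ e₂) G) := by
    intro G hG e₁ e₂ he₁ he₂ m hm
    constructor
    · obtain ⟨z, hz⟩ := (he₁ m hm).1
      obtain ⟨n, hn⟩ := (he₂ z (hG ▸ (mem_adom_of_mem_eval e₁ hz).2)).1
      exact ⟨n, z, hz, hn⟩
    · obtain ⟨z, hz⟩ := (he₂ m hm).2
      obtain ⟨n, hn⟩ := (he₁ z (hG ▸ (mem_adom_of_mem_eval e₂ hz).1)).2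
      exact ⟨n, z, hn, hz⟩
  have hdom : ∀ G : Graph Λ, adom G = V → ∀ A : Set (ℕ × ℕ),
      A = {p : ℕ × ℕ | p.1 = p.2 ∧ p.1 ∈ adom G} → TotalOn V A := by
    rintro G rfl A rfl m hm
    exact ⟨⟨m, rfl, hm⟩, ⟨m, rfl, hm⟩⟩
  induction e with
  | rel R => exact fun _ => .inr (hrel R)
  | empty => exact fun _ => .inl ⟨rfl, rfl⟩
  | id => exact fun _ => .inr hid
  | comp e₁ e₂ ih₁ ih₂ =>
    intro h
    rcases ih₁ h.1 with he₁ | he₁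
    · exact .inl (by simp [eval, he₁])
    rcases ih₂ h.2 with he₂ | he₂
    · exact .inl (by simp [eval, he₂])
    exact .inr ⟨hcomp G₁ h₁ e₁ e₂ he₁.1 he₂.1, hcomp G₂ h₂ e₁ e₂ he₁.2 he₂.2⟩
  | union e₁ e₂ ih₁ ih₂ =>
    intro h
    rcases ih₁ h.1 with he₁ | he₁
    · simpa [eval, he₁] using ih₂ h.2
    · exact .inr ⟨fun m hm => ⟨(he₁.1 m hm).1.imp fun _ => .inl, (he₁.1 m hm).2.imp fun _ => .inl⟩,
        fun m hm => ⟨(he₁.2 m hm).1.imp fun _ => .inl, (he₁.2 m hm).2.imp fun _ => .inl⟩⟩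
  | di => exact fun _ => .inr hdi
  | conv e ih =>
    intro h
    rcases ih h.2 with he | he
    · exact .inl (by simp [eval, he])
    · exact .inr ⟨fun m hm => (he.1 m hm).symm, fun m hm => (he.2 m hm).symm⟩
  | inter e₁ e₂ => exact fun h => (hi h.1).elim
  | diff e₁ e₂ => exact fun h => (hd h.1).elim
  | proj1 e ih =>
    intro h
    rcases ih h.2 with he | he
    · exact .inl (by simp [eval, he])
    · refine .inr ⟨hdom G₁ h₁ _ ?_, hdom G₂ h₂ _ ?_⟩ <;>
      · ext ⟨m, n⟩
        simp only [eval, Set.mem_ofPred_eq]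
        unfold TotalOn at he
        grind
  | proj2 e ih =>
    intro h
    rcases ih h.2 with he | he
    · exact .inl (by simp [eval, he])
    · refine .inr ⟨hdom G₁ h₁ _ ?_, hdom G₂ h₂ _ ?_⟩ <;>
      · ext ⟨m, n⟩
        simp only [eval, Set.mem_ofPred_eq]
        unfold TotalOn at he
        grind
  | coproj1 e ih =>
    intro h
    rcases ih h.2 with he | he
    · exact .inr ⟨hdom G₁ h₁ _ (by simp [eval, he]), hdom G₂ h₂ _ (by simp [eval, he])⟩
    · exact .inl
        ⟨Set.eq_empty_of_forall_notMem fun p hp => hp.2.2 (he.1 p.1 (h₁ ▸ hp.2.1)).1,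
          Set.eq_empty_of_forall_notMem fun p hp => hp.2.2 (he.2 p.1 (h₂ ▸ hp.2.1)).1⟩
  | coproj2 e ih =>
    intro h
    rcases ih h.2 with he | he
    · exact .inr ⟨hdom G₁ h₁ _ (by simp [eval, he]), hdom G₂ h₂ _ (by simp [eval, he])⟩
    · exact .inl
        ⟨Set.eq_empty_of_forall_notMem fun p hp => hp.2.2 (he.1 p.1 (h₁ ▸ hp.2.1)).2,
          Set.eq_empty_of_forall_notMem fun p hp => hp.2.2 (he.2 p.1 (h₂ ▸ hp.2.1)).2⟩

theorem totalOn_listRel {l : List (ℕ × ℕ)}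
    (h : ∀ m ∈ [0, 1], (∃ p ∈ l, p.1 = m) ∧ ∃ p ∈ l, p.2 = m) :
    TotalOn {m | m ∈ [0, 1]} (listRel l) := by
  intro m hm
  obtain ⟨⟨⟨_, n⟩, hp, rfl⟩, ⟨⟨n', _⟩, hq, hq'⟩⟩ := h m hm
  exact ⟨⟨n, hp⟩, ⟨n', by rwa [← hq']⟩⟩

theorem not_leqBool_of_inter [Nonempty Λ] {F₁ F₂ : Set Feature} (h₁ : Feature.inter ∈ F₁)
    (hi : Feature.inter ∉ F₂) (hd : Feature.diff ∉ F₂) : ¬ leqBool Λ F₁ F₂ := by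
  intro h
  let R : Λ := Classical.arbitrary Λ
  obtain ⟨e, he, heq⟩ := h (.inter (.rel R) .id) ⟨h₁, trivial, trivial⟩
  have hpos : (eval (.inter (.rel R) .id)
      (uniform Λ (listRel [(0, 0), (0, 1), (1, 0), (1, 1)]))).Nonempty :=
    ⟨(0, 0), by simp [uniform, eval], rfl, mem_adom_listRel.2 (by decide)⟩
  have hneg : ¬ (eval (.inter (.rel R) .id) (uniform Λ (listRel [(0, 1), (1, 0)]))).Nonempty := by
    rintro ⟨⟨m, n⟩, h, h', -⟩
    obtain rfl : m = n := h'
    simp only [uniform, eval, mem_listRel, List.mem_cons, Prod.mk.injEq, List.not_mem_nil,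
      or_false] at h
    omega
  rw [← heq] at hpos hneg
  rcases eval_empty_or_totalOn hi hd (V := {m | m ∈ [0, 1]})
    (G₁ := uniform Λ (listRel [(0, 0), (0, 1), (1, 0), (1, 1)]))
    (G₂ := uniform Λ (listRel [(0, 1), (1, 0)]))
    (Set.ext fun m => mem_adom_listRel.trans (by simp [nodes]; try omega))
    (Set.ext fun m => mem_adom_listRel.trans (by simp [nodes]; try omega))
    (fun _ => ⟨totalOn_listRel (by decide), totalOn_listRel (by decide)⟩)
    (by
      rw [eval_di_listRel, eval_di_listRel]
      exact ⟨totalOn_listRel (by decide), totalOn_listRel (by decide)⟩) e he with h' | h'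
  · simp [h'.1] at hpos
  · obtain ⟨n, hn⟩ := (h'.2 0 (by simp)).1
    exact hneg ⟨_, hn⟩

theorem eval_subset_of_subset {F : Set Feature} (hd : Feature.diff ∉ F)
    (hc : Feature.coproj ∉ F) {G G' : Graph Λ} (hG : ∀ R, G R ⊆ G' R) (e : Expr Λ) :
    e.InFrag F → eval e G ⊆ eval e G' := by
  have hadom : ∀ m ∈ adom G, m ∈ adom G' := fun m ⟨n, R, h⟩ =>
    ⟨n, R, h.imp (fun h => hG R h) (fun h => hG R h)⟩
  induction e with
  | rel R => exact fun _ => hG R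
  | empty => exact fun _ => subset_rfl
  | id => exact fun _ p hp => ⟨hp.1, hadom _ hp.2⟩
  | comp e₁ e₂ ih₁ ih₂ => exact fun h p ⟨z, hz, hz'⟩ => ⟨z, ih₁ h.1 hz, ih₂ h.2 hz'⟩
  | union e₁ e₂ ih₁ ih₂ => exact fun h => Set.union_subset_union (ih₁ h.1) (ih₂ h.2)
  | di => exact fun _ p hp => ⟨hadom _ hp.1, hadom _ hp.2.1, hp.2.2⟩
  | conv e ih => exact fun h p hp => ih h.2 hp
  | inter e₁ e₂ ih₁ ih₂ => exact fun h => Set.inter_subset_inter (ih₁ h.2.1) (ih₂ h.2.2)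
  | diff e₁ e₂ => exact fun h => (hd h.1).elim
  | proj1 e ih => exact fun h p ⟨hp, hp', n, hn⟩ => ⟨hp, hadom _ hp', n, ih h.2 hn⟩
  | proj2 e ih => exact fun h p ⟨hp, hp', n, hn⟩ => ⟨hp, hadom _ hp', n, ih h.2 hn⟩
  | coproj1 e | coproj2 e => exact fun h => (hc h.1).elim

theorem not_leqBool_of_coproj [Nonempty Λ] {F₁ F₂ : Set Feature} (h₁ : Feature.coproj ∈ F₁)
    (hd : Feature.diff ∉ F₂) (hc : Feature.coproj ∉ F₂) : ¬ leqBool Λ F₁ F₂ := by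
  intro h
  let R : Λ := Classical.arbitrary Λ
  obtain ⟨e, he, heq⟩ := h (.comp (.rel R) (.coproj1 (.rel R))) ⟨trivial, h₁, trivial⟩
  have hpos : (eval (.comp (.rel R) (.coproj1 (.rel R)))
      (uniform Λ (listRel [(0, 1)]))).Nonempty :=
    ⟨(0, 1), 1, by simp [uniform, eval], rfl, mem_adom_listRel.2 (by decide),
      by simp [uniform, eval]⟩
  obtain ⟨p, hp⟩ := (heq _).2 hpos
  have hsub : ∀ R, uniform Λ (listRel [(0, 1)]) R ⊆ uniform Λ (listRel [(0, 1), (1, 1)]) R :=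
    fun _ q hq => List.mem_append_left [(1, 1)] hq
  obtain ⟨⟨m, n⟩, z, hz, -, -, hz'⟩ := (heq _).1 ⟨p, eval_subset_of_subset hd hc hsub e he hp⟩
  simp only [uniform, eval, mem_listRel, List.mem_cons, Prod.mk.injEq, List.not_mem_nil,
    or_false] at hz hz'
  exact hz' ⟨1, by omega⟩

theorem mem_adom_of_automorphism {G : Graph Λ} (σ : Equiv.Perm ℕ)
    (hσ : ∀ R m n, (σ m, σ n) ∈ G R ↔ (m, n) ∈ G R) (m : ℕ) : σ m ∈ adom G ↔ m ∈ adom G := by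
  simp only [adom, Set.mem_ofPred_eq]
  rw [← σ.exists_congr_right]
  simp only [hσ]

theorem mem_eval_of_automorphism {G : Graph Λ} (σ : Equiv.Perm ℕ)
    (hσ : ∀ R m n, (σ m, σ n) ∈ G R ↔ (m, n) ∈ G R) (e : Expr Λ) :
    ∀ m n, (σ m, σ n) ∈ eval e G ↔ (m, n) ∈ eval e G := by
  have hadom := mem_adom_of_automorphism σ hσ
  induction e with
  | rel R => exact hσ R
  | empty => exact fun _ _ => Iff.rfl
  | id => simp [eval, hadom]
  | comp e₁ e₂ ih₁ ih₂ =>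
    intro m n
    simp only [eval, Set.mem_ofPred_eq]
    rw [← σ.exists_congr_right]
    simp only [ih₁, ih₂]
  | union e₁ e₂ ih₁ ih₂ => simp [eval, ih₁, ih₂]
  | di => simp [eval, hadom]
  | conv e ih => exact fun m n => ih n m
  | inter e₁ e₂ ih₁ ih₂ => simp [eval, ih₁, ih₂]
  | diff e₁ e₂ ih₁ ih₂ => simp [eval, ih₁, ih₂]
  | proj1 e ih | proj2 e ih | coproj1 e ih | coproj2 e ih =>
    intro m n
    simp only [eval, Set.mem_ofPred_eq, hadom, σ.injective.eq_iff]
    rw [← σ.exists_congr_right]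
    simp only [ih]

/-- Any two nodes are related by an automorphism of the graph. -/
def VertexTransitive (G : Graph Λ) : Prop :=
  ∀ a b : ℕ, ∃ σ : Equiv.Perm ℕ, σ a = b ∧ ∀ R m n, (σ m, σ n) ∈ G R ↔ (m, n) ∈ G R

theorem VertexTransitive.exists_right {G : Graph Λ} (hG : VertexTransitive G) (e : Expr Λ)
    {a b : ℕ} (h : ∃ n, (a, n) ∈ eval e G) : ∃ n, (b, n) ∈ eval e G := by
  obtain ⟨σ, rfl, hσ⟩ := hG a b
  exact h.imp' σ fun n => (mem_eval_of_automorphism σ hσ e a n).2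

theorem VertexTransitive.exists_left {G : Graph Λ} (hG : VertexTransitive G) (e : Expr Λ)
    {a b : ℕ} (h : ∃ n, (n, a) ∈ eval e G) : ∃ n, (n, b) ∈ eval e G := by
  obtain ⟨σ, rfl, hσ⟩ := hG a b
  exact h.imp' σ fun n => (mem_eval_of_automorphism σ hσ e n a).2

/-- Without difference, vertex transitive graphs that embed into each other are not
distinguished. -/
theorem VertexTransitive.eval_embedding {F : Set Feature} (hd : Feature.diff ∉ F)
    {G G' : Graph Λ} (hG : VertexTransitive G) (hG' : VertexTransitive G') {f : ℕ → ℕ}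
    (hf : f.Injective) (hfG : ∀ R m n, (m, n) ∈ G R → (f m, f n) ∈ G' R)
    (hG'G : ∀ R, G' R ⊆ G R) (e : Expr Λ) :
    e.InFrag F → (∀ m n, (m, n) ∈ eval e G → (f m, f n) ∈ eval e G') ∧
      ∀ m n, (m, n) ∈ eval e G' → (m, n) ∈ eval e G := by
  have h₁ : ∀ m ∈ adom G, f m ∈ adom G' := fun m ⟨n, R, h⟩ =>
    ⟨f n, R, h.imp (hfG R _ _) (hfG R _ _)⟩
  have h₂ : ∀ m ∈ adom G', m ∈ adom G := fun m ⟨n, R, h⟩ =>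
    ⟨n, R, h.imp (fun h => hG'G R h) (fun h => hG'G R h)⟩
  induction e with
  | rel R => exact fun _ => ⟨hfG R, fun _ _ h => hG'G R h⟩
  | empty => exact fun _ => ⟨fun _ _ h => h.elim, fun _ _ h => h⟩
  | id => exact fun _ => ⟨fun m n h => ⟨congrArg f h.1, h₁ m h.2⟩, fun m n h => ⟨h.1, h₂ m h.2⟩⟩
  | comp e₁ e₂ ih₁ ih₂ =>
    exact fun h => ⟨fun m n ⟨z, hz, hz'⟩ => ⟨f z, (ih₁ h.1).1 _ _ hz, (ih₂ h.2).1 _ _ hz'⟩,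
      fun m n ⟨z, hz, hz'⟩ => ⟨z, (ih₁ h.1).2 _ _ hz, (ih₂ h.2).2 _ _ hz'⟩⟩
  | union e₁ e₂ ih₁ ih₂ =>
    exact fun h => ⟨fun m n hmn => hmn.imp ((ih₁ h.1).1 m n) ((ih₂ h.2).1 m n),
      fun m n hmn => hmn.imp ((ih₁ h.1).2 m n) ((ih₂ h.2).2 m n)⟩
  | di =>
    exact fun _ => ⟨fun m n h => ⟨h₁ m h.1, h₁ n h.2.1, fun h' => h.2.2 (hf h')⟩,
      fun m n h => ⟨h₂ m h.1, h₂ n h.2.1, h.2.2⟩⟩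
  | conv e ih => exact fun h => ⟨fun m n => (ih h.2).1 n m, fun m n => (ih h.2).2 n m⟩
  | inter e₁ e₂ ih₁ ih₂ =>
    exact fun h => ⟨fun m n hmn => hmn.imp ((ih₁ h.2.1).1 m n) ((ih₂ h.2.2).1 m n),
      fun m n hmn => hmn.imp ((ih₁ h.2.1).2 m n) ((ih₂ h.2.2).2 m n)⟩
  | diff e₁ e₂ => exact fun h => (hd h.1).elim
  | proj1 e ih =>
    exact fun h => ⟨fun m n ⟨hmn, hm, z, hz⟩ =>
      ⟨congrArg f hmn, h₁ m hm, f z, (ih h.2).1 _ _ hz⟩,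
      fun m n ⟨hmn, hm, z, hz⟩ => ⟨hmn, h₂ m hm, z, (ih h.2).2 _ _ hz⟩⟩
  | proj2 e ih =>
    exact fun h => ⟨fun m n ⟨hmn, hm, z, hz⟩ =>
      ⟨congrArg f hmn, h₁ m hm, f z, (ih h.2).1 _ _ hz⟩,
      fun m n ⟨hmn, hm, z, hz⟩ => ⟨hmn, h₂ m hm, z, (ih h.2).2 _ _ hz⟩⟩
  | coproj1 e ih =>
    exact fun h => ⟨fun m n ⟨hmn, hm, hz⟩ => ⟨congrArg f hmn, h₁ m hm,
      fun ⟨z, hz'⟩ => hz (hG.exists_right e ⟨z, (ih h.2).2 _ _ hz'⟩)⟩,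
      fun m n ⟨hmn, hm, hz⟩ => ⟨hmn, h₂ m hm,
        fun ⟨z, hz'⟩ => hz (hG'.exists_right e ⟨f z, (ih h.2).1 _ _ hz'⟩)⟩⟩
  | coproj2 e ih =>
    exact fun h => ⟨fun m n ⟨hmn, hm, hz⟩ => ⟨congrArg f hmn, h₁ m hm,
      fun ⟨z, hz'⟩ => hz (hG.exists_left e ⟨z, (ih h.2).2 _ _ hz'⟩)⟩,
      fun m n ⟨hmn, hm, hz⟩ => ⟨hmn, h₂ m hm,
        fun ⟨z, hz'⟩ => hz (hG'.exists_left e ⟨f z, (ih h.2).1 _ _ hz'⟩)⟩⟩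

theorem not_leqBool_of_diff [Nonempty Λ] {F₁ F₂ : Set Feature} (h₁ : Feature.diff ∈ F₁)
    (h₂ : Feature.diff ∉ F₂) : ¬ leqBool Λ F₁ F₂ := by
  intro h
  let R : Λ := Classical.arbitrary Λ
  obtain ⟨e, he, heq⟩ := h (.diff (.comp (.rel R) (.rel R)) (.rel R))
    ⟨h₁, ⟨trivial, trivial⟩, trivial⟩
  let φ : ℕ ≃ ℤ := Equiv.intEquivNat.symm
  let r : Set (ℕ × ℕ) := {p | (φ p.1 - φ p.2) % 3 ≠ 2}
  have hpos : (eval (.diff (.comp (.rel R) (.rel R)) (.rel R)) (uniform Λ r)).Nonempty := by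
    refine ⟨(φ.symm 2, φ.symm 0), ⟨φ.symm 1, ?_, ?_⟩, ?_⟩ <;> simp [eval, uniform, r]
  have hneg : ¬ (eval (.diff (.comp (.rel R) (.rel R)) (.rel R))
      (uniform Λ Set.univ)).Nonempty := by
    rintro ⟨p, -, hp⟩
    exact hp trivial
  have htop : VertexTransitive (uniform Λ Set.univ) := fun a b =>
    ⟨Equiv.swap a b, Equiv.swap_apply_left a b, fun _ _ _ => Iff.rfl⟩
  have hr : VertexTransitive (uniform Λ r) := by
    refine fun a b => ⟨(φ.trans (Equiv.addRight (φ b - φ a))).trans φ.symm, by simp, ?_⟩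
    intro _ m n
    simp [uniform, r]
  have hemb := htop.eval_embedding h₂ hr (f := fun n => φ.symm (3 * φ n))
    (fun m n h => by simpa using h)
    (fun _ m n _ => by
      simp only [uniform, r, Set.mem_ofPred_eq, Equiv.apply_symm_apply]
      omega)
    (fun _ => Set.subset_univ _) e he
  obtain ⟨⟨m, n⟩, hmn⟩ := (heq _).2 hpos
  exact hneg ((heq _).1 ⟨_, hemb.2 m n hmn⟩)

end Homogeneity

theorem subset_of_proj_notMem_closure {F : Set Feature} (h : Feature.proj ∉ closure F) :
    F ⊆ {.di, .conv} ∨ F ⊆ {.inter, .diff} := by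
  have hp : Feature.proj ∉ F := fun h' => h (.base h')
  have hc : Feature.coproj ∉ F := fun h' => h (.proj_of_coproj (.base h'))
  by_cases hi : Feature.inter ∈ closure F
  · right
    have hdi : Feature.di ∉ F := fun h' => h (.proj_of_inter_di hi (.base h'))
    have hconv : Feature.conv ∉ F := fun h' => h (.proj_of_inter_conv hi (.base h'))
    rintro (_ | _) <;> simp_all
  · left
    have hi' : Feature.inter ∉ F := fun h' => hi (.base h')
    have hd : Feature.diff ∉ F := fun h' => hi (.inter_of_diff (.base h'))
    rintro (_ | _) <;> simp_all

/-- Features other than converse that occur in `F₁` must be available in the closure of `F₂`. -/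
theorem mem_closure_of_leqBool {Λ : Type} [Nonempty Λ] {F₁ F₂ : Set Feature}
    (h : leqBool Λ F₁ F₂) {x : Feature} (hx : x ∈ F₁) (hconv : x ≠ .conv) : x ∈ closure F₂ := by
  have hproj : ∀ F, leqBool Λ F F₂ → Feature.proj ∈ F → Feature.proj ∈ closure F₂ := by
    intro F hF hpF
    by_contra hp
    rcases subset_of_proj_notMem_closure hp with h' | h'
    · exact not_leqBool_of_proj_of_subset_di_conv hpF h' hF
    · exact not_leqBool_of_proj_of_subset_inter_diff hpF h' hF
  by_contra hx₂
  have hx₂' : x ∉ F₂ := fun h' => hx₂ (.base h')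
  cases x with
  | di => exact not_leqBool_of_di hx hx₂' h
  | conv => exact hconv rfl
  | inter =>
    exact not_leqBool_of_inter hx hx₂' (fun h' => hx₂ (.inter_of_diff (.base h'))) h
  | diff => exact not_leqBool_of_diff hx hx₂' h
  | proj => exact hx₂ (hproj F₁ h hx)
  | coproj =>
    have hp : Feature.proj ∈ closure F₂ :=
      hproj _ ((leqPath_closure Λ F₁).leqBool.trans h) (.proj_of_coproj (.base hx))
    exact not_leqBool_of_coproj hx (fun h' => hx₂ (.coproj_of_diff_proj (.base h') hp)) hx₂' h

theorem tilde_subset_closure_of_leqBool {Λ : Type} [Nonempty Λ] {F₁ F₂ : Set Feature}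
    (h : leqBool Λ F₁ F₂) (hc : Feature.conv ∉ closure F₂) : tilde F₁ ⊆ closure F₂ := by
  have hc' : Feature.conv ∉ F₂ := fun h' => hc (.base h')
  have hF : leqBool Λ (closure F₁) F₂ := (leqPath_closure Λ F₁).leqBool.trans h
  unfold tilde
  split_ifs with hF₁
  · rintro x (⟨hx, hx'⟩ | rfl)
    · exact mem_closure_of_leqBool h hx hx'
    · by_contra hp
      rcases subset_of_proj_notMem_closure hp with h' | h'
      · refine not_leqBool_of_conv_of_subset_di hF₁.1 (fun x hx => ?_) hF
        rcases h' hx with rfl | rfl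
        exacts [rfl, (hc' hx).elim]
      · exact not_leqBool_of_conv_of_subset_inter_diff hF₁.1 h' hF
  · intro x hx
    refine mem_closure_of_leqBool h hx ?_
    rintro rfl
    have hi : Feature.inter ∈ closure F₁ := by
      by_contra hi
      exact hF₁ ⟨.base hx, hi⟩
    exact not_leqBool_of_conv_of_inter (InClosure.base hx) hi hc' hF

/-- For all sets F₁ and F₂ of nonbasic features,
`N(F₁) ≤bool N(F₂)` if and only if `F₁ ⊆ F̄₂` or `F̃₁ ⊆ F̄₂`. -/
theorem bool_order_characterization (Λ : Type) [Fintype Λ] [Nonempty Λ]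
    (F₁ F₂ : Set Feature) :
    leqBool Λ F₁ F₂ ↔ (F₁ ⊆ closure F₂ ∨ tilde F₁ ⊆ closure F₂) := by
  constructor
  · intro h
    by_cases hc : Feature.conv ∈ closure F₂
    · left
      intro x hx
      by_cases hx' : x = .conv
      · exact hx' ▸ hc
      · exact mem_closure_of_leqBool h hx hx'
    · exact .inr (tilde_subset_closure_of_leqBool h hc)
  · rintro (h | h)
    · exact leqBool_of_subset h
    · exact (leqBool_tilde F₁).trans (leqBool_of_subset h)

end NavGraph
end

section
/- Let F be a set of nonbasic features such that ∖ ∉ F and ∩ ∉ F. Then N(F ∪ {⁻¹}) ≤bool N(F ∪ {π}): every boolean query expressible in the extension of N(F) with converse is expressible in the extension of N(F) with projection. -/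
namespace NavGraph

lemma eval_subset_adom {Λ : Type} (G : Graph Λ) (e : Expr Λ) (x y : ℕ)
    (h : (x, y) ∈ eval e G) : x ∈ adom G ∧ y ∈ adom G := by
  induction e generalizing x y with
  | rel R => exact ⟨⟨y, R, Or.inl h⟩, ⟨x, R, Or.inr h⟩⟩
  | empty => exact h.elim
  | id => obtain ⟨hxy : x = y, hx⟩ := h; exact ⟨hx, hxy ▸ hx⟩
  | comp e₁ e₂ ih₁ ih₂ =>
    obtain ⟨z, h₁, h₂⟩ := h
    exact ⟨(ih₁ _ _ h₁).1, (ih₂ _ _ h₂).2⟩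
  | union e₁ e₂ ih₁ ih₂ => exact h.elim (ih₁ _ _) (ih₂ _ _)
  | di => exact ⟨h.1, h.2.1⟩
  | conv e ih => exact (ih _ _ h).symm
  | inter e₁ e₂ ih₁ ih₂ => exact ih₁ _ _ h.1
  | diff e₁ e₂ ih₁ ih₂ => exact ih₁ _ _ h.1
  | proj1 | proj2 | coproj1 | coproj2 => obtain ⟨hxy : x = y, hx, -⟩ := h; exact ⟨hx, hxy ▸ hx⟩

/-- A converse-free expression for the set of nodes connected by `e` to a node satisfying the
test `t`: the preimage of `t` under `e` if the flag is `true`, the image if it is `false`.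
The result is a test again, i.e. a subrelation of the identity. Intersection and difference
are not supported. -/
def Expr.transport {Λ : Type} : Expr Λ → Bool → Expr Λ → Expr Λ
  | .rel R, true, t => .proj1 (.comp (.rel R) t)
  | .rel R, false, t => .proj2 (.comp t (.rel R))
  | .empty, _, _ => .empty
  | .id, _, t => t
  | .comp e₁ e₂, true, t => e₁.transport true (e₂.transport true t)
  | .comp e₁ e₂, false, t => e₂.transport false (e₁.transport false t)
  | .union e₁ e₂, b, t => .union (e₁.transport b t) (e₂.transport b t)
  | .di, _, t => .proj1 (.comp .di t)
  | .conv e, b, t => e.transport (!b) t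
  | .inter _ _, _, _ => .empty
  | .diff _ _, _, _ => .empty
  | .proj1 e, _, t => .comp (e.transport true .id) t
  | .proj2 e, _, t => .comp (e.transport false .id) t
  | .coproj1 e, _, t => .comp (.coproj1 (e.transport true .id)) t
  | .coproj2 e, _, t => .comp (.coproj1 (e.transport false .id)) t

lemma Expr.InFrag.transport {Λ : Type} {F : Set Feature} {e : Expr Λ}
    (he : e.InFrag (F ∪ {Feature.conv})) (b : Bool) {t : Expr Λ}
    (ht : t.InFrag (F ∪ {Feature.proj})) :
    (e.transport b t).InFrag (F ∪ {Feature.proj}) := by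
  induction e generalizing b t with
  | comp e₁ e₂ ih₁ ih₂ =>
    cases b
    · exact ih₂ he.2 _ (ih₁ he.1 _ ht)
    · exact ih₁ he.1 _ (ih₂ he.2 _ ht)
  | conv e ih => exact ih he.2 _ ht
  | proj1 e ih => exact ⟨ih he.2 true trivial, ht⟩
  | proj2 e ih => exact ⟨ih he.2 false trivial, ht⟩
  | coproj1 e ih => exact ⟨⟨Or.inl (he.1.resolve_right nofun), ih he.2 true trivial⟩, ht⟩
  | coproj2 e ih => exact ⟨⟨Or.inl (he.1.resolve_right nofun), ih he.2 false trivial⟩, ht⟩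
  | _ => cases b <;> simp_all [Expr.transport, Expr.InFrag]

lemma mem_eval_transport {Λ : Type} {F : Set Feature} (hdiff : Feature.diff ∉ F)
    (hinter : Feature.inter ∉ F) (G : Graph Λ) {e : Expr Λ}
    (he : e.InFrag (F ∪ {Feature.conv})) (b : Bool) {t : Expr Λ}
    (ht : ∀ x y, (x, y) ∈ eval t G → x = y) (x y : ℕ) :
    (x, y) ∈ eval (e.transport b t) G ↔
      x = y ∧ ∃ z, (z, z) ∈ eval t G ∧ (bif b then (x, z) else (z, x)) ∈ eval e G := by
  have hid : ∀ x y, (x, y) ∈ eval (Expr.id : Expr Λ) G → x = y := fun _ _ h => h.1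
  have hdom := eval_subset_adom G
  induction e generalizing b t x y with
  | rel R =>
    have hR := hdom (.rel R)
    cases b <;> simp [Expr.transport, eval] at hR ⊢ <;> grind
  | empty => simp [Expr.transport, eval]
  | id => cases b <;> simp [Expr.transport, eval] <;> grind
  | comp e₁ e₂ ih₁ ih₂ =>
    have h₁ := fun b x y => ih₁ he.1 b ht x y
    have h₂ := fun b x y => ih₂ he.2 b ht x y
    cases b
    · have h := ih₂ he.2 false (t := e₁.transport false t) fun x y h => ((h₁ _ _ _).1 h).1
      simp only [Expr.transport, h, h₁, eval, cond_false, Set.mem_ofPred_eq]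
      grind
    · have h := ih₁ he.1 true (t := e₂.transport true t) fun x y h => ((h₂ _ _ _).1 h).1
      simp only [Expr.transport, h, h₂, eval, cond_true, Set.mem_ofPred_eq]
      grind
  | union e₁ e₂ ih₁ ih₂ =>
    have h₁ := ih₁ he.1 b ht x y
    have h₂ := ih₂ he.2 b ht x y
    simp only [Expr.transport, eval, Set.mem_union, h₁, h₂]
    grind
  | di => cases b <;> simp [Expr.transport, eval] <;> grind
  | conv e ih =>
    have h := ih he.2 (!b) ht x y
    cases b <;> simpa [Expr.transport, eval] using h
  | inter => exact (he.1.elim hinter nofun).elim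
  | diff => exact (he.1.elim hdiff nofun).elim
  | proj1 e ih =>
    have h := ih he.2 true hid
    have hadom := hdom e
    cases b <;> simp only [Expr.transport, eval, Set.mem_ofPred_eq, h, cond_true, cond_false] <;>
      grind
  | proj2 e ih =>
    have h := ih he.2 false hid
    have hadom := hdom e
    cases b <;> simp only [Expr.transport, eval, Set.mem_ofPred_eq, h, cond_true, cond_false] <;>
      grind
  | coproj1 e ih =>
    have h := ih he.2 true hid
    have hadom := hdom e
    cases b <;> simp only [Expr.transport, eval, Set.mem_ofPred_eq, h, cond_true, cond_false] <;>
      grind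
  | coproj2 e ih =>
    have h := ih he.2 false hid
    have hadom := hdom e
    cases b <;> simp only [Expr.transport, eval, Set.mem_ofPred_eq, h, cond_true, cond_false] <;>
      grind

/-- If `∖ ∉ F` and `∩ ∉ F` then `N(F ∪ {⁻¹}) ≤bool N(F ∪ {π})`. -/
theorem converse_elimination (Λ : Type) [Fintype Λ] [Nonempty Λ]
    (F : Set Feature) (hdiff : Feature.diff ∉ F) (hinter : Feature.inter ∉ F) :
    leqBool Λ (F ∪ {Feature.conv}) (F ∪ {Feature.proj}) := by
  refine fun e he => ⟨e.transport true .id, he.transport true trivial, fun G => ?_⟩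
  have h := mem_eval_transport hdiff hinter G he true (t := .id) fun _ _ h => h.1
  constructor
  · rintro ⟨⟨x, y⟩, hxy⟩
    obtain ⟨-, z, -, hz⟩ := (h x y).1 hxy
    exact ⟨_, hz⟩
  · rintro ⟨⟨x, y⟩, hxy⟩
    exact ⟨(x, x), (h x x).2 ⟨rfl, y, ⟨rfl, (eval_subset_adom G e x y hxy).2⟩, hxy⟩⟩

end NavGraph
end
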